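/- arXiv:2112.09677 — 2 statements merged into one kernel-verified Lean document; each statement's English description precedes it below -/
import Mathlib

section
/- Let k be a field of characteristic not 2 or 3 and let (A,−) be an (m₁,m₂)-product algebra with m₁ ≥ m₂. Then the group schemes Aut(A,−) and Aut(A) are equal (i.e. every automorphism of A, over every commutative k-algebra, preserves the involution) if and only if (m₁,m₂) is one of (1,1), (2,1), (4,1), (8,1), (8,4), (8,8). Consequently, for these values of (m₁,m₂), two (m₁,m₂)-product algebras (A,−) and (A′,−) over k are isomorphic as algebras with involution if and only if A and A′ are isomorphic as algebras. -/
open scoped TensorProduct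

noncomputable section

universe u

/-- A unital, not necessarily associative, algebra with involution over a commutative ring. -/
structure AlgebraWithInvolution (R : Type u) [CommRing R] : Type (u + 1) where
  carrier : Type u
  [isNonAssocRing : NonAssocRing carrier]
  [isModule : Module R carrier]
  [isSMulCommClass : SMulCommClass R carrier carrier]
  [isScalarTower : IsScalarTower R carrier carrier]
  invol : carrier →ₗ[R] carrier
  invol_one : invol 1 = 1
  invol_mul : ∀ x y : carrier, invol (x * y) = invol y * invol x
  invol_invol : ∀ x : carrier, invol (invol x) = x

namespace AlgebraWithInvolution

attribute [instance] isNonAssocRing isModule isSMulCommClass isScalarTower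

instance {R : Type u} [CommRing R] : CoeSort (AlgebraWithInvolution R) (Type u) :=
  ⟨carrier⟩

variable {R : Type u} [CommRing R]

/-- The operator `V_{x,y} z = (x ȳ) z + (z ȳ) x − (z x̄) y` of a (candidate) structurable
algebra. -/
def Vop (A : AlgebraWithInvolution R) (x y z : A) : A :=
  (x * A.invol y) * z + (z * A.invol y) * x - (z * A.invol x) * y

/-- `(A,−)` is a structurable algebra:
`[V_{x,y}, V_{z,w}] = V_{V_{x,y} z, w} − V_{z, V_{y,x} w}`. -/
def IsStructurable (A : AlgebraWithInvolution R) : Prop :=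
  ∀ x y z w v : A,
    A.Vop x y (A.Vop z w v) - A.Vop z w (A.Vop x y v) =
      A.Vop (A.Vop x y z) w v - A.Vop z (A.Vop y x w) v

/-- An element `x` is conjugate-invertible if `V_{x,y} = id` for some `y`. -/
def ConjInvertible (A : AlgebraWithInvolution R) (x : A) : Prop :=
  ∃ y : A, ∀ z : A, A.Vop x y z = z

/-- A structurable division algebra: every nonzero element is conjugate-invertible. -/
def IsStructurableDivisionAlgebra (A : AlgebraWithInvolution R) : Prop :=
  ∀ x : A, x ≠ 0 → A.ConjInvertible x

/-- The submodule of skew elements of an algebra with involution. -/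
def skew (A : AlgebraWithInvolution R) : Submodule R A.carrier where
  carrier := {a | A.invol a = -a}
  add_mem' := by
    intro a b ha hb
    simp only [Set.mem_setOf_eq, map_add] at *
    rw [ha, hb, neg_add]
  zero_mem' := by simp
  smul_mem' := by
    intro c a ha
    simp only [Set.mem_setOf_eq, map_smul] at *
    rw [ha, smul_neg]

/-- `ψ(x,y) = x ȳ − y x̄`. -/
def psi (A : AlgebraWithInvolution R) (x y : A) : A :=
  x * A.invol y - y * A.invol x

/-- Isomorphisms of algebras with involution. -/
structure Iso (A B : AlgebraWithInvolution R) where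
  toLinearEquiv : A.carrier ≃ₗ[R] B.carrier
  map_mul : ∀ x y : A, toLinearEquiv (x * y) = toLinearEquiv x * toLinearEquiv y
  map_one : toLinearEquiv 1 = 1
  map_invol : ∀ x : A, toLinearEquiv (A.invol x) = B.invol (toLinearEquiv x)

/-- Isotopies of (structurable) algebras with involution: pairs `(α, α̂)` of linear
bijections with `α ∘ V_{x,y} ∘ α⁻¹ = V_{α x, α̂ y}`. -/
structure Isotopy (A B : AlgebraWithInvolution R) where
  toLinearEquiv : A.carrier ≃ₗ[R] B.carrier
  hat : A.carrier ≃ₗ[R] B.carrier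
  map_Vop : ∀ x y z : A,
    toLinearEquiv (A.Vop x y z) = B.Vop (toLinearEquiv x) (hat y) (toLinearEquiv z)

/-- Two algebras with involution are isotopic if there is an isotopy between them. -/
def IsIsotopic (A B : AlgebraWithInvolution R) : Prop :=
  Nonempty (A.Isotopy B)

/-- The tensor product of two algebras with involution. -/
def tensor (A B : AlgebraWithInvolution R) : AlgebraWithInvolution R where
  carrier := A.carrier ⊗[R] B.carrier
  invol := TensorProduct.map A.invol B.invol
  invol_one := by
    simp [Algebra.TensorProduct.one_def, A.invol_one, B.invol_one]
  invol_mul := by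
    intro x y
    induction x with
    | zero => simp
    | tmul a b =>
      induction y with
      | zero => simp
      | tmul c d =>
        simp [Algebra.TensorProduct.tmul_mul_tmul, A.invol_mul, B.invol_mul]
      | add u v hu hv =>
        simp only [mul_add, map_add, hu, hv, add_mul]
    | add u v hu hv =>
      simp only [add_mul, map_add, hu, hv, mul_add]
  invol_invol := by
    intro x
    induction x with
    | zero => simp
    | tmul a b => simp [A.invol_invol, B.invol_invol]
    | add u v hu hv => simp [hu, hv]

/-- Base change of an algebra with involution along `R → S`. -/
def baseChange (A : AlgebraWithInvolution R) (S : Type u) [CommRing S] [Algebra R S] :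
    AlgebraWithInvolution S where
  carrier := S ⊗[R] A.carrier
  invol := LinearMap.baseChange S A.invol
  invol_one := by
    simp [Algebra.TensorProduct.one_def, A.invol_one]
  invol_mul := by
    intro x y
    induction x with
    | zero => simp
    | tmul s a =>
      induction y with
      | zero => simp
      | tmul t b =>
        simp only [Algebra.TensorProduct.tmul_mul_tmul, LinearMap.baseChange_tmul,
          A.invol_mul, mul_comm s t]
      | add u v hu hv =>
        simp only [mul_add, map_add, hu, hv, add_mul]
    | add u v hu hv =>
      simp only [add_mul, map_add, hu, hv, mul_add]
  invol_invol := by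
    intro x
    induction x with
    | zero => simp
    | tmul s a => simp [A.invol_invol]
    | add u v hu hv => simp [hu, hv]

end AlgebraWithInvolution

/-- A composition algebra over a field `F`: a unital (possibly non-associative) algebra with a
nondegenerate multiplicative quadratic form, together with its standard involution
`x̄ = b(x,1)·1 − x` (where `b` is the polar form of the norm). -/
structure CompositionAlgebra (F : Type u) [Field F] : Type (u + 1) where
  carrier : Type u
  [isNonAssocRing : NonAssocRing carrier]
  [isModule : Module F carrier]
  [isSMulCommClass : SMulCommClass F carrier carrier]
  [isScalarTower : IsScalarTower F carrier carrier]
  [isFinite : FiniteDimensional F carrier]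
  norm : QuadraticForm F carrier
  norm_one : norm 1 = 1
  norm_mul : ∀ x y : carrier, norm (x * y) = norm x * norm y
  nondegenerate : ∀ x : carrier, (∀ y : carrier, norm (x + y) - norm x - norm y = 0) → x = 0
  conj : carrier →ₗ[F] carrier
  conj_def : ∀ x : carrier, conj x = (norm (x + 1) - norm x - norm 1) • (1 : carrier) - x
  conj_one : conj 1 = 1
  conj_mul : ∀ x y : carrier, conj (x * y) = conj y * conj x
  conj_conj : ∀ x : carrier, conj (conj x) = x

namespace CompositionAlgebra

attribute [instance] isNonAssocRing isModule isSMulCommClass isScalarTower isFinite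

variable {F : Type u} [Field F]

/-- A composition algebra, viewed as an algebra with its standard involution. -/
def toAWI (C : CompositionAlgebra F) : AlgebraWithInvolution F where
  carrier := C.carrier
  invol := C.conj
  invol_one := C.conj_one
  invol_mul := C.conj_mul
  invol_invol := C.conj_conj

end CompositionAlgebra

/-- A splitting datum witnessing that `(A,−)` is an `(m₁, m₂)`-product algebra: a field
extension `K/k` over which `(A,−)` becomes isomorphic, as an algebra with involution, to the
tensor product of two composition algebras (with their standard involutions) of dimensions
`m₁` and `m₂`. -/
structure ProductAlgebraSplitting {k : Type u} [Field k]
    (A : AlgebraWithInvolution k) (m₁ m₂ : ℕ) : Type (u + 1) where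
  K : Type u
  [fieldK : Field K]
  [algK : Algebra k K]
  C₁ : CompositionAlgebra K
  C₂ : CompositionAlgebra K
  finrank₁ : Module.finrank K C₁.carrier = m₁
  finrank₂ : Module.finrank K C₂.carrier = m₂
  iso : (A.baseChange K).Iso (C₁.toAWI.tensor C₂.toAWI)

attribute [instance] ProductAlgebraSplitting.fieldK ProductAlgebraSplitting.algK

/-- `(A,−)` is an `(m₁, m₂)`-product algebra. -/
def IsProductAlgebra {k : Type u} [Field k] (A : AlgebraWithInvolution k) (m₁ m₂ : ℕ) : Prop :=
  Nonempty (ProductAlgebraSplitting A m₁ m₂)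

/-- An Albert form of an `(m₁,m₂)`-product algebra `(A,−)`: a quadratic form `Q` on the space
of skew elements, together with the `♮`-map, satisfying `L_s ∘ L_{s♮} = −Q(s)·id` and such that
`Q(s) ≠ 0` iff left multiplication by `s` is invertible. -/
structure AlbertForm {k : Type u} [Field k] (A : AlgebraWithInvolution k) where
  Q : QuadraticForm k A.skew
  natMap : A.skew →ₗ[k] A.skew
  mul_natMap : ∀ (s : A.skew) (a : A.carrier),
    (s : A.carrier) * ((natMap s : A.carrier) * a) = -(Q s) • a
  nonzero_iff : ∀ s : A.skew,
    Q s ≠ 0 ↔ Function.Bijective fun a : A.carrier => (s : A.carrier) * a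

end

namespace CompositionAlgebra

variable {F : Type u} [Field F] (C : CompositionAlgebra F)

/-- The polar form of the norm of a composition algebra. -/
def bilin : LinearMap.BilinForm F C.carrier := C.norm.polarBilin

lemma bilin_apply (x y : C.carrier) :
    C.bilin x y = C.norm (x + y) - C.norm x - C.norm y := rfl

lemma norm_add (x y : C.carrier) : C.norm (x + y) = C.norm x + C.norm y + C.bilin x y := by
  rw [bilin_apply]; ring

lemma bilin_comm (x y : C.carrier) : C.bilin x y = C.bilin y x := by
  rw [bilin_apply, bilin_apply, add_comm x y]; ring

lemma bilin_self (x : C.carrier) : C.bilin x x = 2 * C.norm x := by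
  have h : C.norm (x + x) = 4 * C.norm x := by
    rw [← two_smul F x, QuadraticMap.map_smul]; simp only [smul_eq_mul]; ring
  rw [bilin_apply, h]; ring

lemma bilin_ext {x y : C.carrier} (h : ∀ z, C.bilin x z = C.bilin y z) : x = y := by
  refine sub_eq_zero.mp (C.nondegenerate _ fun z => ?_)
  rw [← bilin_apply, map_sub, LinearMap.sub_apply, h, sub_self]

lemma conj_eq (x : C.carrier) : C.conj x = C.bilin x 1 • (1 : C.carrier) - x := C.conj_def x

lemma conj_eq_neg {x : C.carrier} (h : C.bilin x 1 = 0) : C.conj x = -x := by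
  rw [conj_eq, h, zero_smul, zero_sub]

lemma bilin_mul_mul_left (x y z : C.carrier) :
    C.bilin (x * y) (x * z) = C.norm x * C.bilin y z := by
  rw [bilin_apply, bilin_apply, ← mul_add]
  simp only [C.norm_mul]; ring

lemma bilin_mul_mul_right (x y z : C.carrier) :
    C.bilin (y * x) (z * x) = C.bilin y z * C.norm x := by
  rw [bilin_apply, bilin_apply, ← add_mul]
  simp only [C.norm_mul]; ring

lemma bilin_mul_mul_add (x w y z : C.carrier) :
    C.bilin (x * y) (w * z) + C.bilin (w * y) (x * z) = C.bilin x w * C.bilin y z := by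
  have h := C.bilin_mul_mul_left (x + w) y z
  simp only [add_mul, map_add, LinearMap.add_apply, norm_add, bilin_mul_mul_left] at h
  linear_combination h

lemma bilin_mul_left (x y z : C.carrier) :
    C.bilin (x * y) z = C.bilin y (C.conj x * z) := by
  have h := C.bilin_mul_mul_add x 1 y z
  simp only [one_mul] at h
  rw [conj_eq, sub_mul, smul_mul_assoc, one_mul, map_sub, map_smul, smul_eq_mul]
  linear_combination h

lemma bilin_mul_right (x y z : C.carrier) :
    C.bilin (x * y) z = C.bilin x (z * C.conj y) := by
  have h := C.bilin_mul_mul_add x z y 1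
  simp only [mul_one] at h
  rw [conj_eq, mul_sub, mul_smul_comm, mul_one, map_sub, map_smul, smul_eq_mul,
    C.bilin_comm x (z * y)]
  linear_combination h

lemma conj_mul_mul (x y : C.carrier) : C.conj x * (x * y) = C.norm x • y := by
  refine C.bilin_ext fun z => ?_
  rw [bilin_mul_left, C.conj_conj, bilin_mul_mul_left, map_smul, LinearMap.smul_apply, smul_eq_mul]

lemma mul_mul_conj (x y : C.carrier) : (y * x) * C.conj x = C.norm x • y := by
  refine C.bilin_ext fun z => ?_
  rw [bilin_mul_right, C.conj_conj, bilin_mul_mul_right, map_smul, LinearMap.smul_apply,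
    smul_eq_mul, mul_comm]

lemma conj_mul_mul_add (x y z : C.carrier) :
    C.conj x * (y * z) + C.conj y * (x * z) = C.bilin x y • z := by
  have h := C.conj_mul_mul (x + y) z
  simp only [map_add, add_mul, mul_add, conj_mul_mul, norm_add, add_smul] at h
  rw [← sub_eq_zero] at h ⊢
  rw [← h]; abel

lemma bilin_conj_conj (x y : C.carrier) : C.bilin (C.conj x) (C.conj y) = C.bilin x y := by
  have h1 := C.bilin_mul_left x (C.conj y) 1
  have h2 := C.bilin_mul_right x (C.conj y) 1
  rw [mul_one] at h1
  rw [one_mul, C.conj_conj] at h2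
  rw [C.bilin_comm, ← h1, h2]

lemma mul_self (x : C.carrier) : x * x = C.bilin x 1 • x - C.norm x • (1 : C.carrier) := by
  have h := C.conj_mul_mul x 1
  rw [mul_one, conj_eq, sub_mul, smul_mul_assoc, one_mul] at h
  rw [← h]; abel

lemma mul_self_mul (x y : C.carrier) : (x * x) * y = x * (x * y) := by
  have h := C.conj_mul_mul x y
  rw [conj_eq, sub_mul, smul_mul_assoc, one_mul] at h
  rw [mul_self, sub_mul, smul_mul_assoc, smul_mul_assoc, one_mul, ← h]; abel

lemma mul_mul_self (x y : C.carrier) : y * (x * x) = (y * x) * x := by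
  have h := C.mul_mul_conj x y
  rw [conj_eq, mul_sub, mul_smul_comm, mul_one] at h
  rw [mul_self, mul_sub, mul_smul_comm, mul_smul_comm, mul_one, ← h]; abel

lemma associator_left (x y z : C.carrier) :
    associator x y z = - associator y x z := by
  have h := C.mul_self_mul (x + y) z
  simp only [add_mul, mul_add, mul_self_mul] at h
  rw [associator_apply, associator_apply, ← sub_eq_zero]
  rw [← sub_eq_zero] at h
  rw [← h]; abel

lemma associator_right (x y z : C.carrier) :
    associator x y z = - associator x z y := by
  have h := C.mul_mul_self (y + z) x
  simp only [add_mul, mul_add, mul_mul_self] at h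
  rw [associator_apply, associator_apply, ← sub_eq_zero]
  rw [← sub_eq_zero] at h
  rw [← neg_eq_zero, ← h]; abel

section Trace

open LinearMap

lemma trace_eq_of_bilin {f g : Module.End F C.carrier}
    (h : ∀ x y, C.bilin (f x) y = C.bilin x (g y)) : trace F _ f = trace F _ g := by
  have hinj : Function.Injective C.bilin := fun x y hxy => C.bilin_ext fun z => by rw [hxy]
  let e : C.carrier ≃ₗ[F] Module.Dual F C.carrier :=
    LinearEquiv.ofInjectiveOfFinrankEq C.bilin hinj Subspace.dual_finrank_eq.symm
  have he : e.conj f = Module.Dual.transpose (R := F) g := by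
    refine LinearMap.ext fun φ => ?_
    obtain ⟨x, rfl⟩ := e.surjective φ
    refine LinearMap.ext fun y => ?_
    rw [LinearEquiv.conj_apply_apply, LinearEquiv.symm_apply_apply]
    exact h x y
  rw [← trace_conj' f e, he, trace_transpose']

lemma two_mul_trace_mulLeft_conj (x y : C.carrier) :
    2 * trace F _ (mulLeft F (C.conj x) * mulLeft F y) =
      Module.finrank F C.carrier * C.bilin x y := by
  have h1 : trace F _ (mulLeft F (C.conj x) * mulLeft F y) =
      trace F _ (mulLeft F (C.conj y) * mulLeft F x) := by
    refine C.trace_eq_of_bilin fun a b => ?_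
    simp only [Module.End.mul_apply, mulLeft_apply]
    rw [bilin_mul_left, bilin_mul_left, C.conj_conj]
  have h3 : mulLeft F (C.conj x) * mulLeft F y + mulLeft F (C.conj y) * mulLeft F x =
      C.bilin x y • (1 : Module.End F C.carrier) := by
    refine LinearMap.ext fun z => ?_
    simpa using C.conj_mul_mul_add x y z
  have h4 := congrArg (trace F _) h3
  rw [map_add, map_smul, trace_one, ← h1, smul_eq_mul] at h4
  linear_combination h4

lemma two_mul_trace_mulLeft_mulLeft (x y : C.carrier) :
    2 * trace F _ (mulLeft F x * mulLeft F y) =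
      Module.finrank F C.carrier * C.bilin x (C.conj y) := by
  have h := C.two_mul_trace_mulLeft_conj (C.conj x) y
  rwa [C.conj_conj, ← C.bilin_conj_conj, C.conj_conj] at h

lemma two_mul_trace_mulLeft (x : C.carrier) :
    2 * trace F _ (mulLeft F x) = Module.finrank F C.carrier * C.bilin x 1 := by
  have h := C.two_mul_trace_mulLeft_mulLeft x 1
  rwa [mulLeft_one, ← Module.End.one_eq_id, mul_one, C.conj_one] at h

lemma two_mul_trace_mulLeft_conj_mulRight (x y : C.carrier) :
    2 * trace F _ (mulLeft F x * C.conj * mulRight F y) =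
      (2 - Module.finrank F C.carrier) * C.bilin x y := by
  have h : mulLeft F x * C.conj * mulRight F y =
      (C.bilin 1).smulRight (x * C.conj y) - mulLeft F x * mulLeft F (C.conj y) := by
    refine LinearMap.ext fun z => ?_
    simp only [Module.End.mul_apply, mulLeft_apply, mulRight_apply, LinearMap.sub_apply,
      LinearMap.smulRight_apply, C.conj_mul]
    rw [C.conj_eq z, C.bilin_comm, mul_sub, mul_sub, mul_smul_comm, mul_smul_comm, mul_one]
  rw [h, map_sub, trace_smulRight, mul_sub, two_mul_trace_mulLeft_mulLeft, C.conj_conj,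
    C.bilin_comm, bilin_mul_right, C.conj_conj, one_mul]
  ring

lemma two_mul_trace_mulLeft_mulRight (x y : C.carrier) :
    2 * trace F _ (mulLeft F x * mulRight F y) =
      2 * C.bilin x (C.conj y) + (Module.finrank F C.carrier - 2) * C.bilin x y := by
  have h : mulLeft F x * mulRight F y =
      (C.bilin 1 ∘ₗ mulRight F y).smulRight x - mulLeft F x * C.conj * mulRight F y := by
    refine LinearMap.ext fun z => ?_
    simp only [Module.End.mul_apply, mulLeft_apply, mulRight_apply, LinearMap.sub_apply,
      LinearMap.smulRight_apply, LinearMap.comp_apply]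
    rw [C.conj_eq (z * y), C.bilin_comm, mul_sub, mul_smul_comm, mul_one]; abel
  rw [h, map_sub, trace_smulRight, mul_sub, two_mul_trace_mulLeft_conj_mulRight,
    LinearMap.comp_apply, mulRight_apply, C.bilin_comm, bilin_mul_right, one_mul]
  ring

lemma bilin_one_mul_bilin_one (x y : C.carrier) :
    C.bilin x 1 * C.bilin y 1 = C.bilin x y + C.bilin x (C.conj y) := by
  rw [C.conj_eq y, map_sub, map_smul, smul_eq_mul]; ring

end Trace
end CompositionAlgebra

noncomputable section TraceForms

open LinearMap TensorProduct

variable (R : Type*) {B : Type*} [CommRing R] [NonAssocRing B] [Module R B]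
  [SMulCommClass R B B] [IsScalarTower R B B]

/-- The bilinear form `(x, y) ↦ tr (L_x L_y)`. -/
def leftLeftForm : LinearMap.BilinForm R B :=
  ((LinearMap.mul R (Module.End R B)).compl₁₂ (LinearMap.mul R B) (LinearMap.mul R B)).compr₂
    (trace R B)

/-- The bilinear form `(x, y) ↦ tr L_x * tr L_y`. -/
def traceProdForm : LinearMap.BilinForm R B :=
  (LinearMap.mul R R).compl₁₂ (trace R B ∘ₗ LinearMap.mul R B) (trace R B ∘ₗ LinearMap.mul R B)

variable {R}

/-- The bilinear form `(x, y) ↦ tr (L_x P R_y)`. -/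
def leftRightForm (P : Module.End R B) : LinearMap.BilinForm R B :=
  ((LinearMap.mul R (Module.End R B)).compl₁₂
    (mulRight R P ∘ₗ LinearMap.mul R B) (LinearMap.mul R B).flip).compr₂ (trace R B)

lemma leftLeftForm_apply (x y : B) :
    leftLeftForm R x y = trace R B (mulLeft R x * mulLeft R y) := rfl

lemma traceProdForm_apply (x y : B) :
    traceProdForm R x y = trace R B (mulLeft R x) * trace R B (mulLeft R y) := rfl

lemma leftRightForm_apply (P : Module.End R B) (x y : B) :
    leftRightForm P x y = trace R B (mulLeft R x * P * mulRight R y) := rfl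

lemma leftLeftForm_isSymm : (leftLeftForm R (B := B)).IsSymm :=
  ⟨fun x y => by
    simp only [leftLeftForm_apply]; rw [trace_mul_comm]⟩

/-- The endomorphism `σ` of `B` is determined by the multiplication through trace forms with
coefficients `a b c d`, by means of an auxiliary endomorphism `P`. -/
structure IsTraceExpressible (σ P : Module.End R B) (a b c d : R) : Prop where
  separating : ∀ x : B, (∀ y, leftLeftForm R x y = 0) → x = 0
  aux : leftLeftForm R ∘ₗ P = leftRightForm 1
  eq : leftLeftForm R ∘ₗ σ =
    a • leftLeftForm R + b • traceProdForm R + c • leftRightForm 1 + d • leftRightForm P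

namespace IsTraceExpressible

section Equiv

variable {B' : Type*} [NonAssocRing B'] [Module R B'] [SMulCommClass R B' B']
  [IsScalarTower R B' B'] (e : B ≃ₗ[R] B') (he : ∀ x y, e (x * y) = e x * e y)

include he in
lemma leftRightForm_equiv {P : Module.End R B} {P' : Module.End R B'}
    (hP : ∀ x, e (P x) = P' (e x)) (x y : B) :
    leftRightForm P' (e x) (e y) = leftRightForm P x y := by
  rw [leftRightForm_apply, leftRightForm_apply, ← trace_conj' _ e]
  congr 1
  refine LinearMap.ext fun z => ?_
  simp [LinearEquiv.conj_apply_apply, he, hP]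

include he in
lemma leftLeftForm_equiv (x y : B) :
    leftLeftForm R (e x) (e y) = leftLeftForm R x y := by
  rw [leftLeftForm_apply, leftLeftForm_apply, ← trace_conj' _ e]
  congr 1
  refine LinearMap.ext fun z => ?_
  simp [LinearEquiv.conj_apply_apply, he]

omit [IsScalarTower R B B] [IsScalarTower R B' B'] in
include he in
lemma trace_mulLeft_equiv (x : B) :
    trace R B' (mulLeft R (e x)) = trace R B (mulLeft R x) := by
  rw [← trace_conj' _ e]
  congr 1
  refine LinearMap.ext fun z => ?_
  simp [LinearEquiv.conj_apply_apply, he]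

include he in
lemma traceProdForm_equiv (x y : B) :
    traceProdForm R (e x) (e y) = traceProdForm R x y := by
  rw [traceProdForm_apply, traceProdForm_apply, trace_mulLeft_equiv e he,
    trace_mulLeft_equiv e he]

variable {σ P : Module.End R B} {σ' P' : Module.End R B'} {a b c d : R}

lemma eq_of_forall (h : IsTraceExpressible σ P a b c d) {x y : B}
    (hxy : ∀ z, leftLeftForm R x z = leftLeftForm R y z) : x = y :=
  sub_eq_zero.mp (h.separating _ fun z => by rw [map_sub, LinearMap.sub_apply, hxy, sub_self])

lemma aux_apply (h : IsTraceExpressible σ P a b c d) (x y : B) :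
    leftLeftForm R (P x) y = leftRightForm 1 x y := by
  rw [← h.aux]; rfl

lemma eq_apply (h : IsTraceExpressible σ P a b c d) (x y : B) :
    leftLeftForm R (σ x) y = a * leftLeftForm R x y + b * traceProdForm R x y +
      c * leftRightForm 1 x y + d * leftRightForm P x y := by
  rw [← LinearMap.comp_apply, h.eq]; rfl

include he in
lemma map_invol (h : IsTraceExpressible σ P a b c d) (h' : IsTraceExpressible σ' P' a b c d)
    (x : B) : e (σ x) = σ' (e x) := by
  have hP : ∀ x, e (P x) = P' (e x) := fun x => h'.eq_of_forall fun z => by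
    obtain ⟨y, rfl⟩ := e.surjective z
    rw [leftLeftForm_equiv e he, h.aux_apply, h'.aux_apply,
      leftRightForm_equiv e he (P := 1) (fun _ => rfl)]
  refine h'.eq_of_forall fun z => ?_
  obtain ⟨y, rfl⟩ := e.surjective z
  rw [leftLeftForm_equiv e he, h.eq_apply, h'.eq_apply, leftLeftForm_equiv e he,
    traceProdForm_equiv e he, leftRightForm_equiv e he hP,
    leftRightForm_equiv e he (P := 1) (fun _ => rfl)]

include he in
lemma of_equiv (h' : IsTraceExpressible σ' P' a b c d) (hσ : ∀ x, e (σ x) = σ' (e x)) :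
    IsTraceExpressible σ (e.symm.conj P') a b c d := by
  have hP : ∀ x, e (e.symm.conj P' x) = P' (e x) := fun x => by
    simp [LinearEquiv.conj_apply_apply]
  refine ⟨fun x hx => ?_, ?_, ?_⟩
  · refine e.map_eq_zero_iff.mp (h'.separating _ fun z => ?_)
    obtain ⟨y, rfl⟩ := e.surjective z
    rw [leftLeftForm_equiv e he, hx]
  · refine LinearMap.ext fun x => LinearMap.ext fun y => ?_
    rw [LinearMap.comp_apply, ← leftLeftForm_equiv e he, hP, h'.aux_apply,
      leftRightForm_equiv e he (P := 1) (fun _ => rfl)]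
  · refine LinearMap.ext fun x => LinearMap.ext fun y => ?_
    rw [LinearMap.comp_apply, ← leftLeftForm_equiv e he, hσ, h'.eq_apply,
      leftLeftForm_equiv e he, traceProdForm_equiv e he, leftRightForm_equiv e he hP,
      leftRightForm_equiv e he (P := 1) (fun _ => rfl)]
    rfl

end Equiv

section BaseChange

variable {k : Type*} [Field k] (S : Type*) [CommRing S] [Algebra k S]
  {A : Type*} [NonAssocRing A] [Module k A] [SMulCommClass k A A] [IsScalarTower k A A]

lemma mulLeft_tmul (s : S) (x : A) :
    mulLeft S (s ⊗ₜ[k] x) = s • (mulLeft k x).baseChange S := by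
  ext z; simp [TensorProduct.smul_tmul']

lemma mulRight_tmul (s : S) (x : A) :
    mulRight S (s ⊗ₜ[k] x) = s • (mulRight k x).baseChange S := by
  ext z; simp [TensorProduct.smul_tmul']

variable [FiniteDimensional k A]

lemma leftLeftForm_tmul (s t : S) (x y : A) :
    leftLeftForm S (s ⊗ₜ[k] x) (t ⊗ₜ[k] y) = s * t * algebraMap k S (leftLeftForm k x y) := by
  rw [leftLeftForm_apply, leftLeftForm_apply, mulLeft_tmul, mulLeft_tmul, smul_mul_smul_comm,
    ← baseChange_mul, map_smul, trace_baseChange, smul_eq_mul]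

lemma traceProdForm_tmul (s t : S) (x y : A) :
    traceProdForm S (s ⊗ₜ[k] x) (t ⊗ₜ[k] y) = s * t * algebraMap k S (traceProdForm k x y) := by
  rw [traceProdForm_apply, traceProdForm_apply, mulLeft_tmul, mulLeft_tmul, map_smul, map_smul,
    trace_baseChange, trace_baseChange, map_mul, smul_eq_mul, smul_eq_mul]
  ring

lemma leftRightForm_tmul (P : Module.End k A) (s t : S) (x y : A) :
    leftRightForm (P.baseChange S) (s ⊗ₜ[k] x) (t ⊗ₜ[k] y) =
      s * t * algebraMap k S (leftRightForm P x y) := by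
  rw [leftRightForm_apply, leftRightForm_apply, mulLeft_tmul, mulRight_tmul, smul_mul_assoc,
    smul_mul_smul_comm, ← baseChange_mul, ← baseChange_mul, map_smul, trace_baseChange,
    smul_eq_mul]

variable {S}

omit [SMulCommClass k A A] [IsScalarTower k A A] [FiniteDimensional k A] in
lemma bilinForm_ext {f g : LinearMap.BilinForm S (S ⊗[k] A)}
    (h : ∀ x y : A, f (1 ⊗ₜ x) (1 ⊗ₜ y) = g (1 ⊗ₜ x) (1 ⊗ₜ y)) : f = g := by
  refine TensorProduct.AlgebraTensorModule.curry_injective ?_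
  refine LinearMap.ext_ring (LinearMap.ext fun x => ?_)
  refine TensorProduct.AlgebraTensorModule.curry_injective ?_
  exact LinearMap.ext_ring (LinearMap.ext fun y => h x y)

variable {σ : Module.End k A} {a b c d : k}

omit [FiniteDimensional k A] in
lemma nondegenerate {P : Module.End k A} (h : IsTraceExpressible σ P a b c d) :
    (leftLeftForm k (B := A)).Nondegenerate :=
  ⟨h.separating, fun x hx => h.separating x fun y => by
    rw [← leftLeftForm_isSymm.eq]; exact hx y⟩

lemma leftLeftForm_separating_baseChange (hB : (leftLeftForm k (B := A)).Nondegenerate)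
    (x : S ⊗[k] A) (hx : ∀ y, leftLeftForm S x y = 0) : x = 0 := by
  let v := Module.finBasis k A
  have key : ∀ z : S ⊗[k] A, z = ∑ i, leftLeftForm S z (1 ⊗ₜ v i) •
      (1 : S) ⊗ₜ[k] (LinearMap.BilinForm.dualBasis _ hB v i) := fun z => by
    induction z with
    | zero => simp
    | tmul s z =>
      conv_lhs => rw [← (LinearMap.BilinForm.dualBasis _ hB v).sum_repr z]
      simp only [LinearMap.BilinForm.dualBasis_repr_apply, leftLeftForm_tmul, mul_one,
        TensorProduct.tmul_sum, TensorProduct.smul_tmul', smul_eq_mul, ← Algebra.commutes,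
        ← Algebra.smul_def, TensorProduct.smul_tmul]
    | add y z hy hz =>
      conv_lhs => rw [hy, hz]
      simp only [map_add, LinearMap.add_apply, add_smul, Finset.sum_add_distrib]
  rw [key x]
  simp [hx]

variable (S) in
lemma baseChange {P : Module.End k A} (h : IsTraceExpressible σ P a b c d) :
    IsTraceExpressible (σ.baseChange S) (P.baseChange S) (algebraMap k S a) (algebraMap k S b)
      (algebraMap k S c) (algebraMap k S d) := by
  have h1 : (1 : Module.End S (S ⊗[k] A)) = (1 : Module.End k A).baseChange S :=
    (baseChange_id ..).symm
  refine ⟨leftLeftForm_separating_baseChange h.nondegenerate, ?_, ?_⟩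
  · refine bilinForm_ext fun x y => ?_
    rw [h1, leftRightForm_tmul, LinearMap.comp_apply, LinearMap.baseChange_tmul,
      leftLeftForm_tmul, h.aux_apply]
  · refine bilinForm_ext fun x y => ?_
    rw [h1]
    simp only [LinearMap.comp_apply, LinearMap.baseChange_tmul, leftLeftForm_tmul, h.eq_apply,
      LinearMap.add_apply, LinearMap.smul_apply, traceProdForm_tmul, leftRightForm_tmul, map_add,
      map_mul, smul_eq_mul, one_mul]

lemma of_baseChange {K : Type*} [Field K] [Algebra k K] {P : Module.End K (K ⊗[k] A)}
    (h : IsTraceExpressible (σ.baseChange K) P (algebraMap k K a) (algebraMap k K b)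
      (algebraMap k K c) (algebraMap k K d)) : ∃ P₀, IsTraceExpressible σ P₀ a b c d := by
  have hinj := (algebraMap k K).injective
  have h1 : (1 : Module.End K (K ⊗[k] A)) = (1 : Module.End k A).baseChange K :=
    (baseChange_id ..).symm
  have hsep : ∀ x : A, (∀ y, leftLeftForm k x y = 0) → x = 0 := fun x hx => by
    have := h.separating (1 ⊗ₜ x) fun z => by
      induction z with
      | zero => simp
      | tmul s y => rw [leftLeftForm_tmul, hx, map_zero, mul_zero]
      | add y z hy hz => rw [map_add, hy, hz, add_zero]
    refine Module.FaithfullyFlat.tensorProduct_mk_injective (A := k) (B := K) A ?_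
    rw [TensorProduct.mk_apply, TensorProduct.mk_apply, this, TensorProduct.tmul_zero]
  have hB : (leftLeftForm k (B := A)).Nondegenerate :=
    ⟨hsep, fun x hx => hsep x fun y => by rw [← leftLeftForm_isSymm.eq]; exact hx y⟩
  let P₀ := LinearMap.BilinForm.symmCompOfNondegenerate (leftRightForm 1) _ hB
  have hP₀ : ∀ x y, leftLeftForm k (P₀ x) y = leftRightForm 1 x y := fun x y =>
    LinearMap.BilinForm.symmCompOfNondegenerate_left_apply _ hB y x
  have hP : P = P₀.baseChange K := by
    refine LinearMap.ext fun x => h.eq_of_forall fun y => ?_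
    rw [h.aux_apply, ← LinearMap.comp_apply]
    refine LinearMap.congr_fun₂ (bilinForm_ext fun x y => ?_) x y
    rw [h1, leftRightForm_tmul, LinearMap.comp_apply, LinearMap.baseChange_tmul,
      leftLeftForm_tmul, hP₀]
  subst hP
  refine ⟨P₀, hsep, LinearMap.ext fun x => LinearMap.ext fun y => hP₀ x y,
    LinearMap.ext fun x => LinearMap.ext fun y => hinj ?_⟩
  have := h.eq_apply (1 ⊗ₜ x) (1 ⊗ₜ y)
  rw [h1, LinearMap.baseChange_tmul] at this
  simp only [leftLeftForm_tmul, traceProdForm_tmul, leftRightForm_tmul, one_mul] at this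
  simpa only [LinearMap.comp_apply, LinearMap.add_apply, LinearMap.smul_apply, map_add,
      map_mul, smul_eq_mul] using this

end BaseChange

section Tensor

variable {K : Type*} [Field K] {A₁ A₂ : Type*}
  [NonAssocRing A₁] [Module K A₁] [SMulCommClass K A₁ A₁] [IsScalarTower K A₁ A₁]
  [NonAssocRing A₂] [Module K A₂] [SMulCommClass K A₂ A₂] [IsScalarTower K A₂ A₂]

lemma mulLeft_tmul_tmul (x : A₁) (y : A₂) :
    mulLeft K (x ⊗ₜ[K] y) = TensorProduct.map (mulLeft K x) (mulLeft K y) := by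
  ext; simp

lemma mulRight_tmul_tmul (x : A₁) (y : A₂) :
    mulRight K (x ⊗ₜ[K] y) = TensorProduct.map (mulRight K x) (mulRight K y) := by
  ext; simp

variable [FiniteDimensional K A₁] [FiniteDimensional K A₂]

lemma leftLeftForm_tmul_tmul (x z : A₁) (y w : A₂) :
    leftLeftForm K (x ⊗ₜ[K] y) (z ⊗ₜ[K] w) = leftLeftForm K x z * leftLeftForm K y w := by
  rw [leftLeftForm_apply, mulLeft_tmul_tmul, mulLeft_tmul_tmul, ← TensorProduct.map_mul,
    trace_tensorProduct']
  rfl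

lemma traceProdForm_tmul_tmul (x z : A₁) (y w : A₂) :
    traceProdForm K (x ⊗ₜ[K] y) (z ⊗ₜ[K] w) = traceProdForm K x z * traceProdForm K y w := by
  rw [traceProdForm_apply, mulLeft_tmul_tmul, mulLeft_tmul_tmul, trace_tensorProduct',
    trace_tensorProduct', traceProdForm_apply, traceProdForm_apply]
  ring

lemma leftRightForm_tmul_tmul (P : Module.End K A₁) (Q : Module.End K A₂)
    (x z : A₁) (y w : A₂) :
    leftRightForm (TensorProduct.map P Q) (x ⊗ₜ[K] y) (z ⊗ₜ[K] w) =
      leftRightForm P x z * leftRightForm Q y w := by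
  rw [leftRightForm_apply, mulLeft_tmul_tmul, mulRight_tmul_tmul, ← TensorProduct.map_mul,
    ← TensorProduct.map_mul, trace_tensorProduct']
  rfl

lemma leftLeftForm_separating_tensor (h₁ : (leftLeftForm K (B := A₁)).Nondegenerate)
    (h₂ : (leftLeftForm K (B := A₂)).Nondegenerate)
    (x : A₁ ⊗[K] A₂) (hx : ∀ y, leftLeftForm K x y = 0) : x = 0 := by
  let v := Module.finBasis K A₁
  let w := Module.finBasis K A₂
  have key : ∀ z : A₁ ⊗[K] A₂, z = ∑ i, ∑ j, leftLeftForm K z (v i ⊗ₜ w j) •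
      (LinearMap.BilinForm.dualBasis _ h₁ v i) ⊗ₜ[K] (LinearMap.BilinForm.dualBasis _ h₂ w j) :=
    fun z => by
      induction z with
      | zero => simp
      | tmul y z =>
        conv_lhs => rw [← (LinearMap.BilinForm.dualBasis _ h₁ v).sum_repr y,
          ← (LinearMap.BilinForm.dualBasis _ h₂ w).sum_repr z]
        simp only [LinearMap.BilinForm.dualBasis_repr_apply, leftLeftForm_tmul_tmul,
          TensorProduct.tmul_sum, TensorProduct.sum_tmul, TensorProduct.smul_tmul_smul]
        rw [Finset.sum_comm]
      | add y z hy hz =>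
        conv_lhs => rw [hy, hz]
        simp only [map_add, LinearMap.add_apply, add_smul, Finset.sum_add_distrib]
  rw [key x]
  simp [hx]

lemma tensor {σ₁ P₁ : Module.End K A₁} {σ₂ P₂ : Module.End K A₂} {a b c d : K}
    (h₁ : (leftLeftForm K (B := A₁)).Nondegenerate)
    (h₂ : (leftLeftForm K (B := A₂)).Nondegenerate)
    (hP₁ : ∀ x y, leftLeftForm K (P₁ x) y = leftRightForm 1 x y)
    (hP₂ : ∀ x y, leftLeftForm K (P₂ x) y = leftRightForm 1 x y)
    (h : ∀ x y z w, leftLeftForm K (σ₁ x) z * leftLeftForm K (σ₂ y) w =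
      a * (leftLeftForm K x z * leftLeftForm K y w) +
      b * (traceProdForm K x z * traceProdForm K y w) +
      c * (leftRightForm 1 x z * leftRightForm 1 y w) +
      d * (leftRightForm P₁ x z * leftRightForm P₂ y w)) :
    IsTraceExpressible (TensorProduct.map σ₁ σ₂) (TensorProduct.map P₁ P₂) a b c d := by
  have h1 : (1 : Module.End K (A₁ ⊗[K] A₂)) = TensorProduct.map 1 1 := TensorProduct.map_one.symm
  refine ⟨leftLeftForm_separating_tensor h₁ h₂, ?_, ?_⟩
  · refine TensorProduct.ext' fun x y => TensorProduct.ext' fun z w => ?_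
    rw [h1, leftRightForm_tmul_tmul, LinearMap.comp_apply, TensorProduct.map_tmul,
      leftLeftForm_tmul_tmul, hP₁, hP₂]
  · refine TensorProduct.ext' fun x y => TensorProduct.ext' fun z w => ?_
    rw [h1]
    simp only [LinearMap.comp_apply, TensorProduct.map_tmul, leftLeftForm_tmul_tmul, h,
      LinearMap.add_apply, LinearMap.smul_apply, traceProdForm_tmul_tmul,
      leftRightForm_tmul_tmul, smul_eq_mul]

end Tensor
end IsTraceExpressible
end TraceForms

namespace CompositionAlgebra

open LinearMap

variable {F : Type u} [Field F] (C : CompositionAlgebra F)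

section Forms

variable (h2 : (2 : F) ≠ 0)
include h2

lemma leftLeftForm_eq (x y : C.carrier) :
    leftLeftForm F x y = Module.finrank F C.carrier / 2 * C.bilin x (C.conj y) := by
  have h := C.two_mul_trace_mulLeft_mulLeft x y
  rw [leftLeftForm_apply]; field_simp; linear_combination h

lemma traceProdForm_eq (x y : C.carrier) :
    traceProdForm F x y =
      (Module.finrank F C.carrier / 2) ^ 2 * (C.bilin x y + C.bilin x (C.conj y)) := by
  have hx := C.two_mul_trace_mulLeft x
  have hy := C.two_mul_trace_mulLeft y
  rw [traceProdForm_apply, ← bilin_one_mul_bilin_one]; field_simp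
  rw [pow_two, show ∀ a b : F, a * b * (2 * 2) = (2 * a) * (2 * b) by intros; ring, hx, hy]
  ring

lemma leftRightForm_one_eq (x y : C.carrier) :
    leftRightForm 1 x y =
      C.bilin x (C.conj y) + (Module.finrank F C.carrier - 2) / 2 * C.bilin x y := by
  have h := C.two_mul_trace_mulLeft_mulRight x y
  rw [leftRightForm_apply, mul_one]; field_simp; linear_combination h

lemma leftRightForm_conj_eq (x y : C.carrier) :
    leftRightForm C.conj x y = (2 - Module.finrank F C.carrier) / 2 * C.bilin x y := by
  have h := C.two_mul_trace_mulLeft_conj_mulRight x y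
  rw [leftRightForm_apply]; field_simp; linear_combination h

lemma leftLeftForm_conj_eq (x y : C.carrier) :
    leftLeftForm F (C.conj x) y = Module.finrank F C.carrier / 2 * C.bilin x y := by
  rw [leftLeftForm_eq C h2, bilin_conj_conj]

lemma leftLeftForm_nondegenerate (hm : (Module.finrank F C.carrier : F) ≠ 0) :
    (leftLeftForm F (B := C.carrier)).Nondegenerate := by
  have h : ∀ x : C.carrier, (∀ y, leftLeftForm F x y = 0) → x = 0 := fun x hx =>
    C.bilin_ext fun z => by
      have := hx (C.conj z)
      rw [leftLeftForm_eq C h2, C.conj_conj] at this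
      rw [map_zero, LinearMap.zero_apply]
      exact (mul_eq_zero.mp this).resolve_left (div_ne_zero hm h2)
  exact ⟨h, fun x hx => h x fun y => by rw [← leftLeftForm_isSymm.eq]; exact hx y⟩

end Forms

/-- The endomorphism relating `leftLeftForm` to `leftRightForm 1`. -/
noncomputable def auxEnd : Module.End F C.carrier :=
  (2 / (Module.finrank F C.carrier : F)) • (1 : Module.End F C.carrier) +
    (1 - 2 / (Module.finrank F C.carrier : F)) • C.conj

lemma leftRightForm_auxEnd (x y : C.carrier) :
    leftRightForm C.auxEnd x y =
      2 / Module.finrank F C.carrier * leftRightForm 1 x y +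
        (1 - 2 / Module.finrank F C.carrier) * leftRightForm C.conj x y := by
  simp only [leftRightForm_apply, auxEnd, mul_add, add_mul, mul_smul_comm, smul_mul_assoc,
    map_add, map_smul, smul_eq_mul]

lemma leftLeftForm_auxEnd (h2 : (2 : F) ≠ 0) (hm : (Module.finrank F C.carrier : F) ≠ 0)
    (x y : C.carrier) : leftLeftForm F (C.auxEnd x) y = leftRightForm 1 x y := by
  rw [auxEnd, LinearMap.add_apply, LinearMap.smul_apply, LinearMap.smul_apply,
    Module.End.one_apply, map_add, map_smul, map_smul, LinearMap.add_apply, LinearMap.smul_apply,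
    LinearMap.smul_apply, leftLeftForm_eq C h2, leftLeftForm_conj_eq C h2,
    leftRightForm_one_eq C h2, smul_eq_mul, smul_eq_mul]
  field_simp

lemma conj_eq_self (h : Module.finrank F C.carrier = 1) (x : C.carrier) : C.conj x = x := by
  have : Nontrivial C.carrier := Module.nontrivial_of_finrank_eq_succ h
  obtain ⟨c, rfl⟩ := (finrank_eq_one_iff_of_nonzero' (1 : C.carrier) one_ne_zero).mp h x
  rw [map_smul, C.conj_one]

lemma isTraceExpressible_tensor (C₁ C₂ : CompositionAlgebra F) {n₁ n₂ : F} (h2 : (2 : F) ≠ 0)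
    (hn₁ : (Module.finrank F C₁.carrier : F) = n₁) (hn₂ : (Module.finrank F C₂.carrier : F) = n₂)
    (h₁ : n₁ ≠ 0) (h₂ : n₂ ≠ 0) {a b c d : F}
    (h : ∀ (x z : C₁.carrier) (y w : C₂.carrier), ∀ p q r s : F, p = C₁.bilin x z →
      q = C₁.bilin x (C₁.conj z) → r = C₂.bilin y w → s = C₂.bilin y (C₂.conj w) →
      n₁ / 2 * p * (n₂ / 2 * r) = a * (n₁ / 2 * q * (n₂ / 2 * s)) +
        b * ((n₁ / 2) ^ 2 * (p + q) * ((n₂ / 2) ^ 2 * (r + s))) +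
        c * ((q + (n₁ - 2) / 2 * p) * (s + (n₂ - 2) / 2 * r)) +
        d * ((2 / n₁ * (q + (n₁ - 2) / 2 * p) + (1 - 2 / n₁) * ((2 - n₁) / 2 * p)) *
          (2 / n₂ * (s + (n₂ - 2) / 2 * r) + (1 - 2 / n₂) * ((2 - n₂) / 2 * r)))) :
    IsTraceExpressible (TensorProduct.map C₁.conj C₂.conj)
      (TensorProduct.map C₁.auxEnd C₂.auxEnd) a b c d := by
  subst hn₁ hn₂
  refine IsTraceExpressible.tensor (C₁.leftLeftForm_nondegenerate h2 h₁)
    (C₂.leftLeftForm_nondegenerate h2 h₂) (C₁.leftLeftForm_auxEnd h2 h₁)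
    (C₂.leftLeftForm_auxEnd h2 h₂) fun x y z w => ?_
  simp only [leftRightForm_auxEnd, leftLeftForm_conj_eq _ h2, leftLeftForm_eq _ h2,
    traceProdForm_eq _ h2, leftRightForm_one_eq _ h2, leftRightForm_conj_eq _ h2]
  exact h x z y w _ _ _ _ rfl rfl rfl rfl

/-- In the listed dimensions, the involution of a product of two composition algebras is
expressible through trace forms with coefficients depending only on the dimensions. -/
lemma exists_isTraceExpressible {k : Type u} [Field k] (hk2 : (2 : k) ≠ 0) (hk3 : (3 : k) ≠ 0)
    {m₁ m₂ : ℕ}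
    (hm : (m₁, m₂) ∈ ({(1, 1), (2, 1), (4, 1), (8, 1), (8, 4), (8, 8)} : Set (ℕ × ℕ))) :
    ∃ a b c d : k, ∀ (K : Type u) [Field K] [Algebra k K] (C₁ C₂ : CompositionAlgebra K),
      Module.finrank K C₁.carrier = m₁ → Module.finrank K C₂.carrier = m₂ →
      IsTraceExpressible (TensorProduct.map C₁.conj C₂.conj)
        (TensorProduct.map C₁.auxEnd C₂.auxEnd) (algebraMap k K a) (algebraMap k K b)
        (algebraMap k K c) (algebraMap k K d) := by
  have H : m₂ = 1 ∧ (m₁ : k) ≠ 0 ∨ m₁ = 8 ∧ m₂ = 4 ∨ m₁ = 8 ∧ m₂ = 8 := by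
    have h4 : (4 : k) ≠ 0 := by
      rw [show (4 : k) = 2 * 2 by norm_num]; exact mul_ne_zero hk2 hk2
    have h8 : (8 : k) ≠ 0 := by
      rw [show (8 : k) = 2 * 4 by norm_num]; exact mul_ne_zero hk2 h4
    simp only [Set.mem_insert_iff, Set.mem_singleton_iff, Prod.mk.injEq] at hm
    rcases hm with ⟨rfl, rfl⟩ | ⟨rfl, rfl⟩ | ⟨rfl, rfl⟩ | ⟨rfl, rfl⟩ | ⟨rfl, rfl⟩ | ⟨rfl, rfl⟩ <;>
      simp [hk2, h4, h8]
  have hK {K : Type u} [Field K] [Algebra k K] {n : ℕ} (h : (n : k) ≠ 0) : (n : K) ≠ 0 := by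
    rw [← map_natCast (algebraMap k K)]
    exact (map_ne_zero _).mpr h
  rcases H with ⟨rfl, h⟩ | ⟨rfl, rfl⟩ | ⟨rfl, rfl⟩
  · refine ⟨-1, 2 / m₁, 0, 0, fun K _ _ C₁ C₂ h₁ h₂ => ?_⟩
    have h2 : (2 : K) ≠ 0 := by exact_mod_cast hK (n := 2) (by exact_mod_cast hk2)
    refine isTraceExpressible_tensor C₁ C₂ h2 (congrArg _ h₁) (congrArg _ h₂) (hK h) (by simp) ?_
    rintro x z y w p q r s - - rfl rfl
    have := hK (K := K) h
    rw [C₂.conj_eq_self h₂]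
    simp only [map_neg, map_one, map_div₀, map_natCast, map_ofNat, map_zero, Nat.cast_one]
    field_simp
    ring
  · refine ⟨-1 / 6, -1 / 16, 4, 32 / 3, fun K _ _ C₁ C₂ h₁ h₂ => ?_⟩
    have h2 : (2 : K) ≠ 0 := by exact_mod_cast hK (n := 2) (by exact_mod_cast hk2)
    have h3 : (3 : K) ≠ 0 := by exact_mod_cast hK (n := 3) (by exact_mod_cast hk3)
    have h4 : (4 : K) ≠ 0 := by
      rw [show (4 : K) = 2 * 2 by norm_num]; exact mul_ne_zero h2 h2
    have h8 : (8 : K) ≠ 0 := by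
      rw [show (8 : K) = 2 * 4 by norm_num]; exact mul_ne_zero h2 h4
    refine isTraceExpressible_tensor C₁ C₂ (n₁ := 8) (n₂ := 4) h2 (by simp [h₁]) (by simp [h₂])
      h8 h4 fun x z y w p q r s _ _ _ _ => ?_
    rw [show (16 : k) = 4 * 4 by norm_num, show (6 : k) = 2 * 3 by norm_num]
    simp only [map_neg, map_one, map_div₀, map_mul, map_ofNat]
    field_simp
    ring
  · refine ⟨1 / 3, -1 / 32, 8 / 3, 0, fun K _ _ C₁ C₂ h₁ h₂ => ?_⟩
    have h2 : (2 : K) ≠ 0 := by exact_mod_cast hK (n := 2) (by exact_mod_cast hk2)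
    have h3 : (3 : K) ≠ 0 := by exact_mod_cast hK (n := 3) (by exact_mod_cast hk3)
    have h4 : (4 : K) ≠ 0 := by
      rw [show (4 : K) = 2 * 2 by norm_num]; exact mul_ne_zero h2 h2
    have h8 : (8 : K) ≠ 0 := by
      rw [show (8 : K) = 2 * 4 by norm_num]; exact mul_ne_zero h2 h4
    refine isTraceExpressible_tensor C₁ C₂ (n₁ := 8) (n₂ := 8) h2 (by simp [h₁]) (by simp [h₂])
      h8 h8 fun x z y w p q r s _ _ _ _ => ?_
    rw [show (32 : k) = 2 * 16 by norm_num, show (16 : k) = 4 * 4 by norm_num]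
    simp only [map_neg, map_one, map_div₀, map_mul, map_ofNat, map_zero]
    field_simp
    ring

end CompositionAlgebra

namespace AlgebraWithInvolution

/-- A product algebra whose dimensions are in the list has its involution expressed by the trace
forms. -/
lemma exists_isTraceExpressible {k : Type u} [Field k] {m₁ m₂ : ℕ} (hm₁ : m₁ ≠ 0) (hm₂ : m₂ ≠ 0)
    {a b c d : k}
    (h : ∀ (K : Type u) [Field K] [Algebra k K] (C₁ C₂ : CompositionAlgebra K),
      Module.finrank K C₁.carrier = m₁ → Module.finrank K C₂.carrier = m₂ →
      IsTraceExpressible (TensorProduct.map C₁.conj C₂.conj)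
        (TensorProduct.map C₁.auxEnd C₂.auxEnd) (algebraMap k K a) (algebraMap k K b)
        (algebraMap k K c) (algebraMap k K d))
    (A : AlgebraWithInvolution k) (hA : IsProductAlgebra A m₁ m₂) :
    FiniteDimensional k A.carrier ∧ ∃ P, IsTraceExpressible A.invol P a b c d := by
  obtain ⟨K, C₁, C₂, h₁, h₂, e⟩ := hA
  have hfin : Module.finrank k A.carrier = m₁ * m₂ := by
    have h3 : Module.finrank K (C₁.carrier ⊗[K] C₂.carrier) = m₁ * m₂ := by
      rw [Module.finrank_tensorProduct, h₁, h₂]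
    have h4 : Module.finrank K (K ⊗[k] A.carrier) = m₁ * m₂ := by
      rw [← h3]; exact e.toLinearEquiv.finrank_eq
    rwa [Module.finrank_baseChange] at h4
  have : FiniteDimensional k A.carrier :=
    Module.finite_of_finrank_pos (by rw [hfin]; positivity)
  refine ⟨this, ?_⟩
  exact (IsTraceExpressible.of_equiv (B := (A.baseChange K).carrier)
    (B' := (C₁.toAWI.tensor C₂.toAWI).carrier) (σ := (A.baseChange K).invol)
    e.toLinearEquiv e.map_mul (h K C₁ C₂ h₁ h₂) e.map_invol).of_baseChange

end AlgebraWithInvolution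

namespace CompositionAlgebra

open LinearMap

variable {F : Type u} [Field F] (C : CompositionAlgebra F)

section Orthogonal

variable {ι : Type*} [Fintype ι] {v : ι → C.carrier}

omit [Fintype ι] in
lemma linearIndependent_of_orthogonal (h2 : (2 : F) ≠ 0)
    (hv : ∀ i j, i ≠ j → C.bilin (v i) (v j) = 0) (hn : ∀ i, C.norm (v i) ≠ 0) :
    LinearIndependent F v :=
  LinearMap.BilinForm.linearIndependent_of_iIsOrtho (B := C.bilin) hv fun i => by
    rw [bilin_self]; exact mul_ne_zero h2 (hn i)

lemma span_eq_top_of_orthogonal (h2 : (2 : F) ≠ 0)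
    (hv : ∀ i j, i ≠ j → C.bilin (v i) (v j) = 0) (hn : ∀ i, C.norm (v i) ≠ 0)
    (hc : Fintype.card ι = Module.finrank F C.carrier) :
    Submodule.span F (Set.range v) = ⊤ :=
  (C.linearIndependent_of_orthogonal h2 hv hn).span_eq_top_of_card_eq_finrank' hc

lemma exists_orthogonal (h2 : (2 : F) ≠ 0)
    (hv : ∀ i j, i ≠ j → C.bilin (v i) (v j) = 0) (hn : ∀ i, C.norm (v i) ≠ 0)
    (hc : Fintype.card ι < Module.finrank F C.carrier) :
    ∃ w, (∀ i, C.bilin w (v i) = 0) ∧ C.norm w ≠ 0 := by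
  classical
  by_contra! H
  let p : C.carrier → C.carrier := fun x =>
    ∑ i, (C.bilin x (v i) / (2 * C.norm (v i))) • v i
  have hp : ∀ x i, C.bilin (x - p x) (v i) = 0 := fun x i => by
    simp only [p, map_sub, map_sum, LinearMap.sub_apply, LinearMap.sum_apply, map_smul,
      LinearMap.smul_apply, smul_eq_mul]
    rw [Finset.sum_eq_single i (fun j _ hj => by rw [hv j i hj, mul_zero]) (by simp), bilin_self,
      div_mul_cancel₀ _ (mul_ne_zero h2 (hn i)), sub_self]
  have hzero : ∀ x, x - p x = 0 := fun x => C.bilin_ext fun y => by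
    rw [map_zero, LinearMap.zero_apply]
    have h1 : C.bilin (x - p x) (p y) = 0 := by
      simp only [p, map_sum, map_smul, hp, smul_zero, Finset.sum_const_zero]
    have h2 : C.bilin (x - p x) (y - p y) = 0 := by
      rw [bilin_apply, H _ (hp x), H _ (hp y), H _ fun i => ?_]
      · simp
      · rw [map_add, LinearMap.add_apply, hp, hp, add_zero]
    rwa [map_sub, h1, sub_zero] at h2
  have hspan : Submodule.span F (Set.range v) = ⊤ := by
    refine eq_top_iff.mpr fun x _ => ?_
    rw [sub_eq_zero.mp (hzero x)]
    exact Submodule.sum_mem _ fun i _ =>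
      Submodule.smul_mem _ _ (Submodule.subset_span (Set.mem_range_self i))
  have := finrank_range_le_card (R := F) v
  rw [Set.finrank, hspan, finrank_top] at this
  omega

lemma exists_orthogonal_one (h2 : (2 : F) ≠ 0) (hc : 1 < Module.finrank F C.carrier) :
    ∃ i, C.bilin i 1 = 0 ∧ C.norm i ≠ 0 := by
  obtain ⟨w, h, hw⟩ := C.exists_orthogonal (v := ![1]) h2
    (fun i j hij => absurd (Subsingleton.elim i j) hij) (by simp [C.norm_one]) (by simpa using hc)
  exact ⟨w, by simpa using h 0, hw⟩

lemma exists_orthogonal_pair (h2 : (2 : F) ≠ 0) (hc : 2 < Module.finrank F C.carrier) :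
    ∃ i j, C.bilin i 1 = 0 ∧ C.norm i ≠ 0 ∧ C.bilin j 1 = 0 ∧ C.bilin i j = 0 ∧ C.norm j ≠ 0 := by
  obtain ⟨i, hi, hni⟩ := C.exists_orthogonal_one h2 (by omega)
  obtain ⟨j, h, hj⟩ := C.exists_orthogonal (v := ![1, i]) h2
    (by simp [Fin.forall_fin_two, hi, C.bilin_comm 1 i])
    (by simp [C.norm_one, hni, Fin.forall_fin_two]) (by simpa using hc)
  exact ⟨i, j, hi, hni, by simpa using h 0, by simpa [C.bilin_comm i j] using h 1, hj⟩

end Orthogonal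

lemma mul_mul_of_bilin_one_eq_zero {i : C.carrier} (hi : C.bilin i 1 = 0) (x : C.carrier) :
    i * (i * x) = -(C.norm i • x) := by
  rw [← C.conj_mul_mul, C.conj_eq_neg hi, neg_mul, neg_neg]

lemma mul_mul_right_of_bilin_one_eq_zero {i : C.carrier} (hi : C.bilin i 1 = 0) (x : C.carrier) :
    (x * i) * i = -(C.norm i • x) := by
  rw [← C.mul_mul_conj, C.conj_eq_neg hi, mul_neg, neg_neg]

lemma anticomm {i j : C.carrier} (hi : C.bilin i 1 = 0) (hj : C.bilin j 1 = 0)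
    (hij : C.bilin i j = 0) : j * i = -(i * j) := by
  have h := C.conj_mul_mul_add i j 1
  rw [C.conj_eq_neg hi, C.conj_eq_neg hj, hij, zero_smul, mul_one, mul_one, neg_mul, neg_mul] at h
  rw [← sub_eq_zero, ← neg_eq_zero, ← h]; abel

section Derivation

/-- A local triality relation between three endomorphisms. -/
def IsTriality (f g h : Module.End F C.carrier) : Prop :=
  ∀ x y, f (x * y) = g x * y + x * h y

lemma IsTriality.lie {C : CompositionAlgebra F} {f g h f' g' h' : Module.End F C.carrier}
    (H : C.IsTriality f g h) (H' : C.IsTriality f' g' h') :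
    C.IsTriality ⁅f, f'⁆ ⁅g, g'⁆ ⁅h, h'⁆ := fun x y => by
  simp only [Ring.lie_def, LinearMap.sub_apply, Module.End.mul_apply, H x y, H' x y, map_add,
    H _ _, H' _ _, sub_mul, mul_sub]
  abel

lemma IsTriality.add {C : CompositionAlgebra F} {f g h f' g' h' : Module.End F C.carrier}
    (H : C.IsTriality f g h) (H' : C.IsTriality f' g' h') :
    C.IsTriality (f + f') (g + g') (h + h') := fun x y => by
  simp only [LinearMap.add_apply, H x y, H' x y, add_mul, mul_add]
  abel

lemma isTriality_mulLeft (a : C.carrier) :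
    C.IsTriality (mulLeft F a) (mulLeft F a + mulRight F a) (-mulLeft F a) := fun x y => by
  have h := C.associator_left a x y
  simp only [associator_apply] at h
  simp only [LinearMap.add_apply, LinearMap.neg_apply, mulLeft_apply, mulRight_apply, add_mul,
    mul_neg]
  rw [← sub_eq_zero] at h ⊢
  rw [← neg_eq_zero, ← h]; abel

lemma isTriality_mulRight (a : C.carrier) :
    C.IsTriality (mulRight F a) (-mulRight F a) (mulLeft F a + mulRight F a) := fun x y => by
  have h := C.associator_right x y a
  simp only [associator_apply] at h
  simp only [LinearMap.add_apply, LinearMap.neg_apply, mulLeft_apply, mulRight_apply, mul_add,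
    neg_mul]
  rw [← sub_eq_zero] at h ⊢
  rw [← h]; abel

lemma lie_mulRight_mulLeft (a b : C.carrier) :
    ⁅mulRight F a, mulLeft F b⁆ = ⁅mulLeft F a, mulRight F b⁆ := by
  refine LinearMap.ext fun x => ?_
  have h : associator b x a = - associator a x b := by
    rw [associator_left, associator_right, neg_neg, associator_left]
  simp only [associator_apply] at h
  simp only [Ring.lie_def, LinearMap.sub_apply, Module.End.mul_apply, mulLeft_apply,
    mulRight_apply]
  rw [h]; abel

/-- The standard inner derivation attached to two elements. -/
def innerDer (a b : C.carrier) : Module.End F C.carrier :=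
  ⁅mulLeft F a, mulLeft F b⁆ + ⁅mulLeft F a, mulRight F b⁆ + ⁅mulRight F a, mulRight F b⁆

lemma innerDer_mul (a b x y : C.carrier) :
    C.innerDer a b (x * y) = C.innerDer a b x * y + x * C.innerDer a b y := by
  have h := (((C.isTriality_mulLeft a).lie (C.isTriality_mulLeft b)).add
    ((C.isTriality_mulLeft a).lie (C.isTriality_mulRight b))).add
    ((C.isTriality_mulRight a).lie (C.isTriality_mulRight b))
  have h0 := C.lie_mulRight_mulLeft a b
  simp only [Ring.lie_def] at h0
  rw [← sub_eq_zero] at h0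
  have h1 : ⁅mulLeft F a + mulRight F a, mulLeft F b + mulRight F b⁆ +
      ⁅mulLeft F a + mulRight F a, -mulRight F b⁆ + ⁅-mulRight F a, -mulRight F b⁆ =
      C.innerDer a b := by
    simp only [Ring.lie_def, innerDer, add_mul, mul_add, neg_mul, mul_neg]
    rw [← sub_eq_zero, ← h0]; abel
  have h2 : ⁅-mulLeft F a, -mulLeft F b⁆ + ⁅-mulLeft F a, mulLeft F b + mulRight F b⁆ +
      ⁅mulLeft F a + mulRight F a, mulLeft F b + mulRight F b⁆ = C.innerDer a b := by
    simp only [Ring.lie_def, innerDer, add_mul, mul_add, neg_mul, mul_neg]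
    rw [← sub_eq_zero, ← h0]; abel
  rw [h1, h2] at h
  exact h x y

lemma innerDer_self {a b : C.carrier} (ha : C.bilin a 1 = 0) (hb : C.bilin b 1 = 0)
    (hab : C.bilin a b = 0) : C.innerDer a b a = (4 * C.norm a) • b := by
  have h1 : a * a = -(C.norm a • (1 : C.carrier)) := by
    rw [← C.mul_mul_of_bilin_one_eq_zero ha, mul_one]
  have h2 := C.anticomm ha hb hab
  have h3 : a * b = -(b * a) := by rw [h2, neg_neg]
  simp only [innerDer, Ring.lie_def, LinearMap.add_apply, LinearMap.sub_apply,
    Module.End.mul_apply, mulLeft_apply, mulRight_apply]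
  rw [h2, mul_neg, C.mul_mul_of_bilin_one_eq_zero ha, h3, neg_mul,
    C.mul_mul_right_of_bilin_one_eq_zero ha, h1]
  simp only [mul_neg, neg_mul, mul_smul_comm, smul_mul_assoc, one_mul, mul_one]
  module

end Derivation

end CompositionAlgebra

namespace CompositionAlgebra

open LinearMap

variable {F : Type u} [Field F] (C : CompositionAlgebra F)

section Quaternion

variable {C} {ι : Type*} {v : ι → C.carrier}

lemma associator_eq_zero_of_span (hv : Submodule.span F (Set.range v) = ⊤) {x y : C.carrier}
    (h : ∀ l, associator x y (v l) = 0) (z : C.carrier) : associator x y z = 0 := by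
  have : mulLeft F (x * y) - mulLeft F x ∘ₗ mulLeft F y = 0 :=
    LinearMap.ext_on_range hv fun l => by simpa [associator_apply] using h l
  simpa [associator_apply] using LinearMap.congr_fun this z

lemma associator_cyclic (x y z : C.carrier) : associator x y z = associator y z x := by
  rw [C.associator_left, C.associator_right, neg_neg]

lemma associator_eq_zero_of_forall (hv : Submodule.span F (Set.range v) = ⊤)
    (h : ∀ l m n, associator (v l) (v m) (v n) = 0) (x y z : C.carrier) :
    associator x y z = 0 := by
  have h1 : ∀ l m z, associator (v l) (v m) z = 0 := fun l m =>
    associator_eq_zero_of_span hv (h l m)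
  have h2 : ∀ l y z, associator (v l) y z = 0 := fun l y z => by
    rw [C.associator_right, associator_eq_zero_of_span hv (fun m => ?_), neg_zero]
    rw [C.associator_right, h1, neg_zero]
  rw [associator_cyclic]
  exact associator_eq_zero_of_span hv (fun l => by rw [← associator_cyclic, h2]) x

lemma associator_self_left (x y : C.carrier) : associator x x y = 0 := by
  rw [associator_apply, C.mul_self_mul, sub_self]

lemma associator_self_right (x y : C.carrier) : associator x y y = 0 := by
  rw [associator_cyclic, associator_self_left]

lemma associator_self_mid (x y : C.carrier) : associator x y x = 0 := by
  rw [associator_cyclic, associator_self_right]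

lemma associator_one_left (x y : C.carrier) : associator 1 x y = 0 := by
  rw [associator_apply, one_mul, one_mul, sub_self]

lemma associator_one_mid (x y : C.carrier) : associator x 1 y = 0 := by
  rw [associator_cyclic, associator_one_left]

lemma associator_one_right (x y : C.carrier) : associator x y 1 = 0 := by
  rw [associator_cyclic, associator_one_mid]

variable (C) in
lemma mul_assoc_of_finrank_eq_four (h2 : (2 : F) ≠ 0) (hc : Module.finrank F C.carrier = 4)
    (x y z : C.carrier) : x * y * z = x * (y * z) := by
  obtain ⟨i, j, hi, hni, hj, hij, hnj⟩ := C.exists_orthogonal_pair h2 (by omega)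
  have hk1 : C.bilin (i * j) 1 = 0 := by
    rw [C.bilin_mul_left, C.conj_eq_neg hi, neg_mul, mul_one, map_neg, C.bilin_comm, hij, neg_zero]
  have hki : C.bilin (i * j) i = 0 := by
    have := C.bilin_mul_mul_left i j 1
    rwa [mul_one, hj, mul_zero] at this
  have hkj : C.bilin (i * j) j = 0 := by
    have := C.bilin_mul_mul_right j i 1
    rwa [one_mul, hi, zero_mul] at this
  have hkk : (i * j) * (i * j) = -((C.norm i * C.norm j) • (1 : C.carrier)) := by
    rw [← C.norm_mul, ← C.mul_mul_of_bilin_one_eq_zero hk1, mul_one]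
  have hii : i * i = -(C.norm i • (1 : C.carrier)) := by
    rw [← C.mul_mul_of_bilin_one_eq_zero hi, mul_one]
  have hijk : associator i j (i * j) = 0 := by
    have : i * (j * (i * j)) = (i * j) * (i * j) := by
      rw [hkk, ← neg_neg (i * j), ← C.anticomm hi hj hij, mul_neg,
        C.mul_mul_of_bilin_one_eq_zero hj, neg_neg, mul_smul_comm, hii, smul_neg, smul_smul,
        mul_comm]
    rw [associator_apply, this, sub_self]
  rw [← sub_eq_zero]
  refine associator_eq_zero_of_forall (v := ![1, i, j, i * j])
    (C.span_eq_top_of_orthogonal h2 ?_ ?_ (by simp [hc])) ?_ x y z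
  · simp [Fin.forall_fin_succ, hi, hj, hij, hk1, hki, hkj, C.bilin_comm 1, C.bilin_comm j i,
      C.bilin_comm _ (i * j)]
  · simp [Fin.forall_fin_succ, C.norm_one, C.norm_mul, hni, hnj]
  · have h3 : associator j (i * j) i = 0 := by rw [← associator_cyclic, hijk]
    have h4 : associator (i * j) i j = 0 := by rw [associator_cyclic, hijk]
    simp [Fin.forall_fin_succ, associator_self_left, associator_self_right, associator_self_mid,
      associator_one_left, associator_one_mid, associator_one_right, hijk, h3, h4,
      C.associator_left j i, C.associator_left (i * j) j, C.associator_left i (i * j)]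

end Quaternion

section Derivation

open TensorProduct

variable {C} {C' : CompositionAlgebra F}

lemma derivation_ext {D : Module.End F (C.carrier ⊗[F] C'.carrier)}
    (h : ∀ x y z w, D (x ⊗ₜ y * z ⊗ₜ w) = D (x ⊗ₜ y) * z ⊗ₜ w + x ⊗ₜ y * D (z ⊗ₜ w))
    (x y : C.carrier ⊗[F] C'.carrier) : D (x * y) = D x * y + x * D y := by
  induction x with
  | zero => simp
  | add u v hu hv => simp only [add_mul, map_add, hu, hv]; abel
  | tmul x z =>
    induction y with
    | zero => simp
    | add u v hu hv => simp only [mul_add, map_add, hu, hv]; abel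
    | tmul y w => exact h x z y w

lemma tmul_ne_zero (h2 : (2 : F) ≠ 0) {x : C.carrier} {y : C'.carrier}
    (hx : C.norm x ≠ 0) (hy : C'.norm y ≠ 0) :
    x ⊗ₜ[F] y ≠ 0 := fun h => by
  have := congrArg (LinearMap.mul' F F ∘ₗ TensorProduct.map (C.bilin x) (C'.bilin y)) h
  simp [bilin_self, h2, hx, hy] at this

/-- Left multiplication by an element of a two-dimensional composition algebra commutes with
all multiplications. -/
lemma mul_comm_assoc_of_finrank_eq_two (h2 : (2 : F) ≠ 0) (hc : Module.finrank F C.carrier = 2)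
    {j : C.carrier} (hj : C.bilin j 1 = 0) (hnj : C.norm j ≠ 0) (x y : C.carrier) :
    j * (x * y) = j * x * y ∧ j * (x * y) = x * (j * y) := by
  have hspan := C.span_eq_top_of_orthogonal (v := ![1, j]) h2
    (by simp [Fin.forall_fin_succ, hj, C.bilin_comm 1])
    (by simp [Fin.forall_fin_succ, C.norm_one, hnj]) (by simp [hc])
  have ha : ∀ x y z : C.carrier, x * y * z = x * (y * z) := fun x y z =>
    sub_eq_zero.mp <| associator_eq_zero_of_forall hspan
      (by simp [Fin.forall_fin_succ, associator_self_left, associator_one_left,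
        associator_one_mid, associator_one_right]) x y z
  have hj : mulLeft F j = mulRight F j :=
    LinearMap.ext_on_range hspan (by simp [Fin.forall_fin_succ])
  have hjx : j * x = x * j := LinearMap.congr_fun hj x
  exact ⟨(ha j x y).symm, by rw [← ha, hjx, ha]⟩

lemma exists_derivation_of_finrank_eq_two (h2 : (2 : F) ≠ 0)
    (hc : 2 < Module.finrank F C.carrier) (hc' : Module.finrank F C'.carrier = 2) :
    ∃ D : Module.End F (C.carrier ⊗[F] C'.carrier),
      (∀ x y, D (x * y) = D x * y + x * D y) ∧
      ∃ x, D (TensorProduct.map C.conj C'.conj x) ≠ TensorProduct.map C.conj C'.conj (D x) := by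
  obtain ⟨a, b, ha, hna, hb, hab, hnb⟩ := C.exists_orthogonal_pair h2 hc
  obtain ⟨j, hj, hnj⟩ := C'.exists_orthogonal_one h2 (by omega)
  refine ⟨TensorProduct.map (C.innerDer a b) (mulLeft F j), derivation_ext fun x y z w => ?_,
    a ⊗ₜ 1, fun h => ?_⟩
  · obtain ⟨h, h'⟩ := mul_comm_assoc_of_finrank_eq_two h2 hc' hj hnj y w
    simp only [Algebra.TensorProduct.tmul_mul_tmul, TensorProduct.map_tmul, mulLeft_apply,
      innerDer_mul, TensorProduct.add_tmul]
    rw [← h, ← h']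
  · rw [TensorProduct.map_tmul, TensorProduct.map_tmul, TensorProduct.map_tmul,
      C.innerDer_self ha hb hab, C.conj_eq_neg ha, C'.conj_one, map_neg,
      C.innerDer_self ha hb hab, mulLeft_apply, mul_one, TensorProduct.map_tmul, map_smul,
      C.conj_eq_neg hb,
      C'.conj_eq_neg hj, TensorProduct.neg_tmul, smul_neg, TensorProduct.neg_tmul,
      TensorProduct.tmul_neg, neg_neg, neg_eq_iff_add_eq_zero, ← two_smul F,
      TensorProduct.smul_tmul', smul_smul, ← TensorProduct.smul_tmul'] at h
    refine (smul_ne_zero ?_ (tmul_ne_zero h2 hnb hnj)) h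
    have : (4 : F) ≠ 0 := by rw [show (4 : F) = 2 * 2 by norm_num]; exact mul_ne_zero h2 h2
    exact mul_ne_zero h2 (mul_ne_zero this hna)

lemma exists_derivation_of_finrank_eq_four (h2 : (2 : F) ≠ 0)
    (hc : Module.finrank F C.carrier = 4) (hc' : Module.finrank F C'.carrier = 4) :
    ∃ D : Module.End F (C.carrier ⊗[F] C'.carrier),
      (∀ x y, D (x * y) = D x * y + x * D y) ∧
      ∃ x, D (TensorProduct.map C.conj C'.conj x) ≠ TensorProduct.map C.conj C'.conj (D x) := by
  obtain ⟨a, b, ha, hna, hb, hab, hnb⟩ := C.exists_orthogonal_pair h2 (by omega)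
  obtain ⟨j, hj, hnj⟩ := C'.exists_orthogonal_one h2 (by omega)
  refine ⟨mulLeft F (a ⊗ₜ j) - mulRight F (a ⊗ₜ j), derivation_ext fun x y z w => ?_,
    b ⊗ₜ 1, fun h => ?_⟩
  · simp only [Algebra.TensorProduct.tmul_mul_tmul, LinearMap.sub_apply, mulLeft_apply,
      mulRight_apply, sub_mul, mul_sub, C.mul_assoc_of_finrank_eq_four h2 hc,
      C'.mul_assoc_of_finrank_eq_four h2 hc']
    abel
  · have hab1 : C.bilin (a * b) 1 = 0 := by
      rw [C.bilin_mul_left, C.conj_eq_neg ha, neg_mul, mul_one, map_neg, C.bilin_comm, hab,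
        neg_zero]
    have hD : (mulLeft F (a ⊗ₜ[F] j) - mulRight F (a ⊗ₜ[F] j)) (b ⊗ₜ 1) =
        (2 : F) • ((a * b) ⊗ₜ[F] j) := by
      rw [LinearMap.sub_apply, mulLeft_apply, mulRight_apply, Algebra.TensorProduct.tmul_mul_tmul,
        Algebra.TensorProduct.tmul_mul_tmul, mul_one, one_mul, C.anticomm ha hb hab,
        TensorProduct.neg_tmul, sub_neg_eq_add, two_smul]
    rw [TensorProduct.map_tmul, C.conj_eq_neg hb, C'.conj_one, TensorProduct.neg_tmul, map_neg,
      hD, map_smul, TensorProduct.map_tmul, C.conj_eq_neg hab1, C'.conj_eq_neg hj,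
      TensorProduct.neg_tmul, TensorProduct.tmul_neg, neg_neg, neg_eq_iff_add_eq_zero,
      ← two_smul F, smul_smul] at h
    refine (smul_ne_zero (mul_ne_zero h2 h2) (tmul_ne_zero h2 ?_ hnj)) h
    rw [C.norm_mul]; exact mul_ne_zero hna hnb

end Derivation

end CompositionAlgebra

noncomputable section InfinitesimalAutomorphism

open TensorProduct

variable {k : Type*} [Field k] {K R : Type*} [Field K] [Algebra k K] [CommRing R] [Algebra k R]
  {A : Type*} [NonAssocRing A] [Module k A] {f : K →ₐ[k] R} {ε : R} {D : Module.End K (K ⊗[k] A)}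

lemma rTensor_algHom_baseChange (φ : A →ₗ[k] A) (x : K ⊗[k] A) :
    f.toLinearMap.rTensor A (φ.baseChange K x) = φ.baseChange R (f.toLinearMap.rTensor A x) := by
  induction x with
  | zero => simp
  | add u v hu hv => simp only [map_add, hu, hv]
  | tmul t b => simp

lemma smul_rTensor_algHom_injective {p : R →ₗ[k] K} (hp : ∀ s, p (ε * f s) = s) {x y : K ⊗[k] A}
    (h : ε • f.toLinearMap.rTensor A x = ε • f.toLinearMap.rTensor A y) : x = y := by
  have key : ∀ z, p.rTensor A (ε • f.toLinearMap.rTensor A z) = z := fun z => by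
    induction z with
    | zero => simp
    | add u v hu hv => simp only [map_add, smul_add, hu, hv]
    | tmul t b => simp [TensorProduct.smul_tmul', hp]
  rw [← key x, h, key]

variable (f D) in
/-- The extension of an endomorphism of `K ⊗ A` to `R ⊗ A` along `f : K → R`. -/
def extendEnd : Module.End R (R ⊗[k] A) :=
  LinearMap.liftBaseChange R
    (f.toLinearMap.rTensor A ∘ₗ D.restrictScalars k ∘ₗ TensorProduct.mk k K A 1)

lemma extendEnd_tmul (s : R) (a : A) :
    extendEnd f D (s ⊗ₜ a) = s • f.toLinearMap.rTensor A (D (1 ⊗ₜ a)) := by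
  simp [extendEnd]

variable (f D) in
/-- The automorphism `1 + ε D` of `R ⊗ A` attached to `ε : R` of square zero. -/
def infinitesimalAut (hε : ε * ε = 0) : (R ⊗[k] A) ≃ₗ[R] (R ⊗[k] A) :=
  LinearEquiv.ofLinearMap (1 + ε • extendEnd f D) (1 + (-ε) • extendEnd f D)
    (LinearMap.ext fun x => by
      simp only [LinearMap.comp_apply, LinearMap.add_apply, LinearMap.smul_apply,
        Module.End.one_apply, map_add, map_smul, smul_add, smul_smul, neg_mul, hε, neg_zero,
        zero_smul, LinearMap.id_apply]
      module)
    (LinearMap.ext fun x => by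
      simp only [LinearMap.comp_apply, LinearMap.add_apply, LinearMap.smul_apply,
        Module.End.one_apply, map_add, map_smul, smul_add, smul_smul, mul_neg, hε, neg_zero,
        zero_smul, LinearMap.id_apply]
      module)

lemma infinitesimalAut_apply (hε : ε * ε = 0) (x : R ⊗[k] A) :
    infinitesimalAut f D hε x = x + ε • extendEnd f D x := rfl

lemma comm_of_infinitesimalAut_comm {p : R →ₗ[k] K} (hp : ∀ s, p (ε * f s) = s) (hε : ε * ε = 0)
    {φ : A →ₗ[k] A}
    (h : ∀ x, infinitesimalAut f D hε (φ.baseChange R x) =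
      φ.baseChange R (infinitesimalAut f D hε x))
    (x : K ⊗[k] A) : D (φ.baseChange K x) = φ.baseChange K (D x) := by
  have h1 : ∀ a, D (φ.baseChange K (1 ⊗ₜ a)) = φ.baseChange K (D (1 ⊗ₜ a)) := fun a => by
    refine smul_rTensor_algHom_injective hp ?_
    have := h (1 ⊗ₜ a)
    rw [infinitesimalAut_apply, infinitesimalAut_apply, map_add, LinearMap.baseChange_tmul,
      add_right_inj, map_smul,
      extendEnd_tmul, extendEnd_tmul, one_smul, one_smul, ← rTensor_algHom_baseChange] at this
    rwa [LinearMap.baseChange_tmul]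
  refine LinearMap.congr_fun (f := D ∘ₗ φ.baseChange K) (g := φ.baseChange K ∘ₗ D) ?_ x
  exact TensorProduct.AlgebraTensorModule.curry_injective
    (LinearMap.ext_ring (LinearMap.ext h1))

variable [SMulCommClass k A A] [IsScalarTower k A A]

lemma rTensor_algHom_mul (x y : K ⊗[k] A) :
    f.toLinearMap.rTensor A (x * y) = f.toLinearMap.rTensor A x * f.toLinearMap.rTensor A y := by
  induction x with
  | zero => simp
  | add u v hu hv => simp only [add_mul, map_add, hu, hv]
  | tmul s a =>
    induction y with
    | zero => simp
    | add u v hu hv => simp only [mul_add, map_add, hu, hv]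
    | tmul t b => simp [Algebra.TensorProduct.tmul_mul_tmul]

lemma extendEnd_mul (hD : ∀ x y, D (x * y) = D x * y + x * D y) (x y : R ⊗[k] A) :
    extendEnd f D (x * y) = extendEnd f D x * y + x * extendEnd f D y := by
  induction x with
  | zero => simp
  | add u v hu hv => simp only [add_mul, map_add, hu, hv]; abel
  | tmul s a =>
    induction y with
    | zero => simp
    | add u v hu hv => simp only [mul_add, map_add, hu, hv]; abel
    | tmul t b =>
      have h := congrArg (f.toLinearMap.rTensor A) (hD (1 ⊗ₜ a) (1 ⊗ₜ b))
      have hs : ∀ (s : R) (a : A), s ⊗ₜ[k] a = s • f.toLinearMap.rTensor A (1 ⊗ₜ a) := fun s a => by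
        simp [TensorProduct.smul_tmul']
      rw [map_add, rTensor_algHom_mul, rTensor_algHom_mul, Algebra.TensorProduct.tmul_mul_tmul,
        one_mul] at h
      rw [Algebra.TensorProduct.tmul_mul_tmul, extendEnd_tmul, extendEnd_tmul, extendEnd_tmul,
        h, hs s a, hs t b, smul_mul_smul_comm, smul_mul_smul_comm, smul_add]

lemma infinitesimalAut_mul (hD : ∀ x y, D (x * y) = D x * y + x * D y) (hε : ε * ε = 0)
    (x y : R ⊗[k] A) :
    infinitesimalAut f D hε (x * y) = infinitesimalAut f D hε x * infinitesimalAut f D hε y := by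
  simp only [infinitesimalAut_apply, extendEnd_mul hD, add_mul, mul_add, smul_add,
    smul_mul_assoc, mul_smul_comm, smul_smul, hε, zero_smul]
  abel

lemma infinitesimalAut_one (hD : ∀ x y, D (x * y) = D x * y + x * D y) (hε : ε * ε = 0) :
    infinitesimalAut f D hε 1 = 1 := by
  have h := extendEnd_mul (f := f) hD 1 1
  rw [mul_one, mul_one, one_mul, left_eq_add] at h
  rw [infinitesimalAut_apply, h, smul_zero, add_zero]

end InfinitesimalAutomorphism

namespace AlgebraWithInvolution

/-- If every automorphism over every commutative `k`-algebra preserves the involution, then so does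
every derivation over every field extension. -/
lemma invol_comm_derivation {k : Type u} [Field k] (A : AlgebraWithInvolution k)
    (h : ∀ (R : Type u) [CommRing R] [Algebra k R]
      (e : (A.baseChange R).carrier ≃ₗ[R] (A.baseChange R).carrier),
      (∀ x y : (A.baseChange R).carrier, e (x * y) = e x * e y) → e 1 = 1 →
        ∀ x : (A.baseChange R).carrier,
          e ((A.baseChange R).invol x) = (A.baseChange R).invol (e x))
    {K : Type u} [Field K] [Algebra k K] {D : Module.End K (A.baseChange K).carrier}
    (hD : ∀ x y, D (x * y) = D x * y + x * D y) (x : (A.baseChange K).carrier) :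
    D ((A.baseChange K).invol x) = (A.baseChange K).invol (D x) :=
  comm_of_infinitesimalAut_comm (f := TrivSqZeroExt.inlAlgHom k K K) (ε := DualNumber.eps)
    (p := (TrivSqZeroExt.sndHom K K).restrictScalars k) (fun s => by simp)
    DualNumber.eps_mul_eps
    (h (DualNumber K) (infinitesimalAut _ D _) (infinitesimalAut_mul hD _)
      (infinitesimalAut_one hD _)) x

/-- The transport of derivations along an isomorphism. -/
lemma Iso.invol_comm_derivation {F : Type u} [Field F] {A B : AlgebraWithInvolution F}
    (e : A.Iso B)
    (h : ∀ D : Module.End F A.carrier, (∀ x y, D (x * y) = D x * y + x * D y) →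
      ∀ x, D (A.invol x) = A.invol (D x))
    {D : Module.End F B.carrier} (hD : ∀ x y, D (x * y) = D x * y + x * D y) (x : B.carrier) :
    D (B.invol x) = B.invol (D x) := by
  have hmul : ∀ x y, e.toLinearEquiv.symm (x * y) =
      e.toLinearEquiv.symm x * e.toLinearEquiv.symm y := fun x y => by
    rw [LinearEquiv.symm_apply_eq, e.map_mul]; simp
  have := h (e.toLinearEquiv.symm.conj D)
    (fun x y => by simp [LinearEquiv.conj_apply_apply, e.map_mul, hD, hmul])
    (e.toLinearEquiv.symm x)
  simpa [LinearEquiv.conj_apply_apply, e.map_invol, ← LinearEquiv.symm_apply_eq] using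
    congrArg e.toLinearEquiv this

end AlgebraWithInvolution

namespace AlgebraWithInvolution

variable {k : Type u} [Field k]

lemma exists_isTraceExpressible_of_mem (hk2 : (2 : k) ≠ 0) (hk3 : (3 : k) ≠ 0) {m₁ m₂ : ℕ}
    (hm : (m₁, m₂) ∈ ({(1, 1), (2, 1), (4, 1), (8, 1), (8, 4), (8, 8)} : Set (ℕ × ℕ))) :
    ∃ a b c d : k, ∀ A : AlgebraWithInvolution k, IsProductAlgebra A m₁ m₂ →
      FiniteDimensional k A.carrier ∧ ∃ P, IsTraceExpressible A.invol P a b c d := by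
  obtain ⟨a, b, c, d, h⟩ := CompositionAlgebra.exists_isTraceExpressible hk2 hk3 hm
  have hne : m₁ ≠ 0 ∧ m₂ ≠ 0 := by
    simp only [Set.mem_insert_iff, Set.mem_singleton_iff, Prod.mk.injEq] at hm; omega
  exact ⟨a, b, c, d, fun A => exists_isTraceExpressible hne.1 hne.2 h A⟩

end AlgebraWithInvolution

namespace CompositionAlgebra

lemma exists_derivation_of_notMem {F : Type u} [Field F] (h2 : (2 : F) ≠ 0) {m₁ m₂ : ℕ}
    (hm₁ : m₁ ∈ ({1, 2, 4, 8} : Set ℕ)) (hm₂ : m₂ ∈ ({1, 2, 4, 8} : Set ℕ))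
    (hne : (m₁, m₂) ≠ (2, 2)) (hle : m₂ ≤ m₁)
    (hm : (m₁, m₂) ∉ ({(1, 1), (2, 1), (4, 1), (8, 1), (8, 4), (8, 8)} : Set (ℕ × ℕ)))
    {C₁ C₂ : CompositionAlgebra F} (h₁ : Module.finrank F C₁.carrier = m₁)
    (h₂ : Module.finrank F C₂.carrier = m₂) :
    ∃ D : Module.End F (C₁.carrier ⊗[F] C₂.carrier),
      (∀ x y, D (x * y) = D x * y + x * D y) ∧
      ∃ x, D (TensorProduct.map C₁.conj C₂.conj x) ≠ TensorProduct.map C₁.conj C₂.conj (D x) := by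
  have : (2 < m₁ ∧ m₂ = 2) ∨ (m₁ = 4 ∧ m₂ = 4) := by
    simp only [Set.mem_insert_iff, Set.mem_singleton_iff] at hm₁ hm₂
    clear h₁ h₂
    rcases hm₁ with rfl | rfl | rfl | rfl <;> rcases hm₂ with rfl | rfl | rfl | rfl <;> simp_all
  rcases this with ⟨h, h'⟩ | ⟨h, h'⟩
  · exact exists_derivation_of_finrank_eq_two h2 (h₁ ▸ h) (h₂.trans h')
  · exact exists_derivation_of_finrank_eq_four h2 (h₁.trans h) (h₂.trans h')

end CompositionAlgebra

/-- Let `k` be a field of characteristic not 2 or 3 and let `(A,−)` be an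
`(m₁,m₂)`-product algebra with `m₁ ≥ m₂`.  The group schemes `Aut(A,−)` and `Aut(A)` are equal
(i.e. for every commutative `k`-algebra `R`, every `R`-algebra automorphism of `A ⊗ R` preserves
the involution) if and only if `(m₁,m₂)` is one of `(1,1), (2,1), (4,1), (8,1), (8,4), (8,8)`.
Consequently, for these values of `(m₁,m₂)`, two `(m₁,m₂)`-product algebras are isomorphic as
algebras with involution iff they are isomorphic as algebras. -/
theorem aut_preserves_involution_iff
    {k : Type u} [Field k] (hk2 : (2 : k) ≠ 0) (hk3 : (3 : k) ≠ 0)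
    (m₁ m₂ : ℕ) (hm₁ : m₁ ∈ ({1, 2, 4, 8} : Set ℕ)) (hm₂ : m₂ ∈ ({1, 2, 4, 8} : Set ℕ))
    (hne : (m₁, m₂) ≠ (2, 2)) (hle : m₂ ≤ m₁) :
    (∀ A : AlgebraWithInvolution k, IsProductAlgebra A m₁ m₂ →
      ((∀ (R : Type u) [CommRing R] [Algebra k R]
          (e : (A.baseChange R).carrier ≃ₗ[R] (A.baseChange R).carrier),
          (∀ x y : (A.baseChange R).carrier, e (x * y) = e x * e y) → e 1 = 1 →
            ∀ x : (A.baseChange R).carrier,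
              e ((A.baseChange R).invol x) = (A.baseChange R).invol (e x)) ↔
        (m₁, m₂) ∈ ({(1, 1), (2, 1), (4, 1), (8, 1), (8, 4), (8, 8)} : Set (ℕ × ℕ)))) ∧
    ((m₁, m₂) ∈ ({(1, 1), (2, 1), (4, 1), (8, 1), (8, 4), (8, 8)} : Set (ℕ × ℕ)) →
      ∀ A A' : AlgebraWithInvolution k,
        IsProductAlgebra A m₁ m₂ → IsProductAlgebra A' m₁ m₂ →
        (Nonempty (A.Iso A') ↔
          ∃ e : A.carrier ≃ₗ[k] A'.carrier,
            (∀ x y : A.carrier, e (x * y) = e x * e y) ∧ e 1 = 1)) := by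
  refine ⟨fun A hA => ⟨fun h => ?_, fun hm R _ _ e he _ x => ?_⟩, fun hm A A' hA hA' =>
    ⟨fun ⟨e⟩ => ⟨e.toLinearEquiv, e.map_mul, e.map_one⟩, fun ⟨e, he, h1⟩ => ⟨⟨e, he, h1, ?_⟩⟩⟩⟩
  · by_contra hm
    obtain ⟨S⟩ := hA
    have h2 : (2 : S.K) ≠ 0 := by
      rw [← map_ofNat (algebraMap k S.K) 2]
      exact (map_ne_zero _).mpr hk2
    obtain ⟨D, hD, x, hx⟩ := CompositionAlgebra.exists_derivation_of_notMem h2 hm₁ hm₂ hne hle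
      hm S.finrank₁ S.finrank₂
    exact hx (S.iso.invol_comm_derivation (fun _ => A.invol_comm_derivation h) hD x)
  · obtain ⟨a, b, c, d, H⟩ := AlgebraWithInvolution.exists_isTraceExpressible_of_mem hk2 hk3 hm
    obtain ⟨_, P, hP⟩ := H A hA
    exact IsTraceExpressible.map_invol e he (hP.baseChange R) (hP.baseChange R) x
  · obtain ⟨a, b, c, d, H⟩ := AlgebraWithInvolution.exists_isTraceExpressible_of_mem hk2 hk3 hm
    obtain ⟨_, P, hP⟩ := H A hA
    obtain ⟨_, P', hP'⟩ := H A' hA'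
    exact IsTraceExpressible.map_invol e he hP hP'
end

section
/- Let k be a field of characteristic not 2 or 3 and let (A,−) be an (m₁,m₂)-product algebra with S = Skew(A,−) and Albert form Q. For every commutative k-algebra R and every isotopy α ∈ Str(A_R,−), the linear map α_S : S_R → S_R defined by α_S(s) = ½ψ(α(s),α(1)) is a similitude of the quadratic form Q_R, and α ↦ α_S defines a homomorphism of algebraic groups γ: Str(A,−) → GO(S,Q). -/
open scoped TensorProduct

universe u

/-- If two quadratic forms satisfy `Q' · l = Q · y` for linear forms `l` and `y`, and `Q` takes a
unit value on `ker l`, then `Q'` is a multiple of `Q`. -/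
theorem QuadraticMap.exists_eq_mul_of_mul_linear_eq {R M : Type*} [CommRing R] [AddCommGroup M]
    [Module R M] (h2 : IsUnit (2 : R)) (Q Q' : QuadraticForm R M) (l y : M →ₗ[R] R) {e t : M}
    (hle : l e = 0) (hlt : l t = 1) (he : IsUnit (Q e))
    (h : ∀ s, Q' s * l s = Q s * y s) : ∃ μ : R, ∀ s, Q' s = μ * Q s := by
  have add_sub : ∀ (P : QuadraticForm R M) (v w : M),
      P (v + w) + P (v - w) = 2 * P v + 2 * P w := by
    intro P v w
    have h₁ := QuadraticMap.map_add P v w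
    have h₂ := QuadraticMap.map_add P v (-w)
    rw [QuadraticMap.polar_neg_right, QuadraticMap.map_neg, ← sub_eq_add_neg] at h₂
    rw [h₁, h₂]
    ring
  have hye : y e = 0 := by
    have := h e
    rw [hle, mul_zero] at this
    exact (he.mul_right_eq_zero).1 this.symm
  have hker : ∀ v, l v = 0 → y v = 0 := by
    intro v hv
    have h₀ := h v
    have h₁ := h (v + e)
    have h₂ := h (v - e)
    simp only [map_add, map_sub, hv, hle, hye, add_zero, sub_zero, mul_zero] at h₀ h₁ h₂
    have h₃ : 2 * (Q e * y v) = 0 := by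
      linear_combination 2 * h₀ - h₁ - h₂ - y v * add_sub Q v e
    exact he.mul_right_eq_zero.1 (h2.mul_right_eq_zero.1 h₃)
  have hy : ∀ s, y s = l s * y t := by
    intro s
    have := hker (s - l s • t) (by simp [hlt])
    simpa [sub_eq_zero] using this
  refine ⟨y t, ?_⟩
  set G : QuadraticForm R M := Q' - y t • Q with hG
  have hGapp : ∀ s, G s = Q' s - y t * Q s := fun s => by simp [hG]
  have hGl : ∀ s, G s * l s = 0 := by
    intro s
    rw [hGapp]
    linear_combination h s + Q s * hy s
  have hGt : G t = 0 := by simpa [hlt] using hGl t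
  have hGv : ∀ v, l v = 0 → G v = 0 ∧ QuadraticMap.polar G v t = 0 := by
    intro v hv
    have h₁ : G (v + t) = 0 := by simpa [hlt, hv] using hGl (v + t)
    have h₂ : G (v - t) = 0 := by simpa [hlt, hv] using hGl (v - t)
    have h₃ : 2 * G v = 0 := by linear_combination h₁ + h₂ - add_sub G v t - 2 * hGt
    have h₄ := h2.mul_right_eq_zero.1 h₃
    exact ⟨h₄, by rw [QuadraticMap.polar, h₁, h₄, hGt]; ring⟩
  intro s
  obtain ⟨h₁, h₂⟩ := hGv (s - l s • t) (by simp [hlt])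
  have h₃ := QuadraticMap.map_add G (s - l s • t) (l s • t)
  rw [sub_add_cancel, h₁, QuadraticMap.polar_smul_right, h₂, QuadraticMap.map_smul, hGt] at h₃
  rw [← sub_eq_zero, ← hGapp, h₃]
  simp

theorem baseChange_mul_baseChange_mul {k R S X : Type*} [Field k] [Invertible (2 : k)]
    [CommRing R] [Algebra k R] [AddCommGroup S] [Module k S] [NonAssocRing X] [Module k X]
    [SMulCommClass k X X] [IsScalarTower k X X] (Q : QuadraticForm k S) (f g : S →ₗ[k] X)
    (h : ∀ s a, f s * (g s * a) = -Q s • a) (v : R ⊗[k] S) (a : R ⊗[k] X) :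
    f.baseChange R v * (g.baseChange R v * a) = -(Q.baseChange R v) • a := by
  have hpol : ∀ s t a, f s * (g t * a) + f t * (g s * a) = -QuadraticMap.polar Q s t • a := by
    intro s t a
    have hst := h (s + t) a
    have hs := h s a
    have ht := h t a
    simp only [map_add, add_mul, mul_add, hs, ht] at hst
    simp only [QuadraticMap.polar, neg_smul, sub_smul] at hst ⊢
    rw [← sub_eq_zero] at hst ⊢
    rw [← hst]
    abel
  let _ : Invertible (2 : R) := (Invertible.map (algebraMap k R) 2).copy 2 (map_ofNat _ 2).symm
  have key : ∀ v w : R ⊗[k] S, ∀ a : R ⊗[k] X,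
      f.baseChange R v * (g.baseChange R w * a) + f.baseChange R w * (g.baseChange R v * a) =
        -(LinearMap.BilinForm.baseChange R (QuadraticMap.polarBilin Q) v w) • a := by
    intro v w a
    induction v with
    | zero => simp
    | add v₁ v₂ h₁ h₂ =>
      simp only [map_add, add_mul, mul_add, LinearMap.add_apply, neg_add, add_smul, ← h₁, ← h₂]
      abel
    | tmul r s =>
      induction w with
      | zero => simp
      | add w₁ w₂ h₁ h₂ =>
        simp only [map_add, add_mul, mul_add, neg_add, add_smul, ← h₁, ← h₂]
        abel
      | tmul r' t =>
        induction a with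
        | zero => simp
        | add a₁ a₂ h₁ h₂ =>
          simp only [mul_add, smul_add, ← h₁, ← h₂]
          abel
        | tmul c a =>
          simp only [LinearMap.baseChange_tmul, Algebra.TensorProduct.tmul_mul_tmul,
            LinearMap.BilinForm.baseChange_tmul, QuadraticMap.polarBilin_apply_apply,
            ← mul_assoc, mul_comm r' r, ← TensorProduct.tmul_add, hpol]
          rw [TensorProduct.tmul_smul, TensorProduct.smul_tmul', TensorProduct.smul_tmul', neg_smul,
            smul_eq_mul, neg_mul, smul_mul_assoc]
  have h₂ := key v v a
  rw [← QuadraticForm.polarBilin_baseChange, QuadraticMap.polarBilin_apply_apply,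
    QuadraticMap.polar_self, ← two_smul R] at h₂
  refine (isUnit_of_invertible (2 : R)).smul_left_cancel.1 (h₂.trans ?_)
  rw [smul_smul, mul_neg, nsmul_eq_mul, Nat.cast_ofNat]

namespace AlgebraWithInvolution

section General

variable {R : Type u} [CommRing R] {A B : AlgebraWithInvolution R}

theorem Vop_sub_Vop (A : AlgebraWithInvolution R) (x y z : A) :
    A.Vop x z y - A.Vop y z x = A.psi x y * z := by
  simp only [Vop, psi, sub_mul]
  abel

theorem psi_one_of_invol_eq_neg (A : AlgebraWithInvolution R) {s : A} (hs : A.invol s = -s) :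
    A.psi s 1 = (2 : R) • s := by
  simp [psi, A.invol_one, hs, two_smul]

theorem invol_psi (A : AlgebraWithInvolution R) (x y : A) : A.invol (A.psi x y) = -A.psi x y := by
  simp [psi, A.invol_mul, A.invol_invol]

theorem Isotopy.map_psi_mul (I : A.Isotopy B) (x y z : A) :
    I.toLinearEquiv (A.psi x y * z) =
      B.psi (I.toLinearEquiv x) (I.toLinearEquiv y) * I.hat z := by
  rw [← Vop_sub_Vop, ← Vop_sub_Vop, map_sub, I.map_Vop, I.map_Vop]

/-- The inverse of an isotopy. -/
def Isotopy.symm (I : A.Isotopy B) : B.Isotopy A where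
  toLinearEquiv := I.toLinearEquiv.symm
  hat := I.hat.symm
  map_Vop x y z := by
    rw [LinearEquiv.symm_apply_eq, I.map_Vop]
    simp

theorem Isotopy.psi_congr (I : A.Isotopy B) {x y x' y' : A} (h : A.psi x y = A.psi x' y') :
    B.psi (I.toLinearEquiv x) (I.toLinearEquiv y) =
      B.psi (I.toLinearEquiv x') (I.toLinearEquiv y') := by
  have h₁ := I.map_psi_mul x y (I.hat.symm 1)
  have h₂ := I.map_psi_mul x' y' (I.hat.symm 1)
  rw [h, h₂] at h₁
  simpa using h₁.symm

theorem Isotopy.map_mul_of_skew (I : A.Isotopy B) {c : R} (hc : c * 2 = 1) {s : A}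
    (hs : A.invol s = -s) (a : A) :
    I.toLinearEquiv (s * a) =
      (c • B.psi (I.toLinearEquiv s) (I.toLinearEquiv 1)) * I.hat a := by
  rw [smul_mul_assoc, ← I.map_psi_mul, A.psi_one_of_invol_eq_neg hs, smul_mul_assoc, map_smul,
    smul_smul, hc, one_smul]

/-- If `L_s L_{s♮} = L_{s♮} L_s = −Q(s)` on the image of `i`, and `β` is the map induced on that
image by an isotopy, then `β` relates the `♮`-maps by a cubic identity. -/
theorem Isotopy.smul_natMap_eq {M : Type*} [AddCommGroup M] [Module R M]
    (I : A.Isotopy A) (i : M →ₗ[R] A.carrier) (n : M → M) (Q : M → R)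
    (h₁ : ∀ v a, i v * (i (n v) * a) = -Q v • a) (h₂ : ∀ v a, i (n v) * (i v * a) = -Q v • a)
    (β : M → M) (hβ : ∀ v a, I.toLinearEquiv (i v * a) = i (β v) * I.hat a) (v : M) (a : A) :
    Q v • (i (n (β v)) * I.toLinearEquiv a) = Q (β v) • I.hat (i (n v) * a) := by
  have h := congrArg (fun x => i (n (β v)) * x) (hβ v (i (n v) * a))
  simpa only [h₁, h₂, map_smul, mul_smul_comm, neg_smul, map_neg, mul_neg, neg_inj] using h

end General

section BaseChange

variable {k : Type u} [Field k] (A : AlgebraWithInvolution k) (R : Type u) [CommRing R]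
  [Algebra k R]

/-- The inclusion of the base change of the skew elements into the base change of the algebra. -/
def skewInclusion : R ⊗[k] A.skew →ₗ[R] (A.baseChange R).carrier :=
  LinearMap.baseChange R A.skew.subtype

theorem invol_skewInclusion (v : R ⊗[k] A.skew) :
    (A.baseChange R).invol (A.skewInclusion R v) = -A.skewInclusion R v := by
  induction v with
  | zero => simp
  | add v w hv hw => rw [map_add, map_add, hv, hw, neg_add]
  | tmul r s =>
    have hs : A.invol s = -s := s.2
    change r ⊗ₜ[k] A.invol s = -(r ⊗ₜ[k] (s : A.carrier))
    rw [hs, TensorProduct.tmul_neg]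

variable [Invertible (2 : k)]

/-- The projection `a ↦ ½(a − ā)` onto the skew elements. -/
def skewProjection : A.carrier →ₗ[k] A.skew :=
  LinearMap.codRestrict A.skew (⅟ (2 : k) • (LinearMap.id - A.invol)) fun a => by
    change A.invol (⅟ (2 : k) • (a - A.invol a)) = -(⅟ (2 : k) • (a - A.invol a))
    rw [map_smul, map_sub, A.invol_invol, ← smul_neg, neg_sub]

/-- The base change of `skewProjection`. -/
def skewProjectionBaseChange : (A.baseChange R).carrier →ₗ[R] R ⊗[k] A.skew :=
  LinearMap.baseChange R A.skewProjection

theorem skewProjection_coe (s : A.skew) : A.skewProjection s = s := by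
  have hs : A.invol s = -s := s.2
  apply Subtype.ext
  change ⅟ (2 : k) • ((s : A.carrier) - A.invol s) = s
  rw [hs, sub_neg_eq_add, ← two_smul k, smul_smul, invOf_mul_self, one_smul]

theorem skewProjectionBaseChange_skewInclusion (v : R ⊗[k] A.skew) :
    A.skewProjectionBaseChange R (A.skewInclusion R v) = v := by
  induction v with
  | zero => simp
  | add v w hv hw => rw [map_add, map_add, hv, hw]
  | tmul r s =>
    change r ⊗ₜ[k] A.skewProjection s = _
    rw [skewProjection_coe]

theorem algebraMap_invOf_two_mul_two : algebraMap k R (⅟ (2 : k)) * 2 = 1 := by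
  rw [← map_ofNat (algebraMap k R) 2, ← map_mul, invOf_mul_self, map_one]

theorem skewInclusion_skewProjectionBaseChange (x : A.baseChange R) :
    A.skewInclusion R (A.skewProjectionBaseChange R x) =
      algebraMap k R (⅟ (2 : k)) • (x - (A.baseChange R).invol x) := by
  let f : R ⊗[k] A.carrier →ₗ[R] R ⊗[k] A.carrier :=
    LinearMap.baseChange R A.skew.subtype ∘ₗ LinearMap.baseChange R A.skewProjection
  let g : R ⊗[k] A.carrier →ₗ[R] R ⊗[k] A.carrier :=
    algebraMap k R (⅟ (2 : k)) • (LinearMap.id - LinearMap.baseChange R A.invol)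
  suffices h : f = g from LinearMap.congr_fun h x
  refine TensorProduct.AlgebraTensorModule.curry_injective (LinearMap.ext fun r =>
    LinearMap.ext fun a => ?_)
  change r ⊗ₜ[k] (⅟ (2 : k) • (a - A.invol a)) =
    algebraMap k R (⅟ (2 : k)) • (r ⊗ₜ[k] a - r ⊗ₜ[k] A.invol a)
  rw [← TensorProduct.tmul_sub, TensorProduct.tmul_smul, algebraMap_smul]

theorem skewInclusion_skewProjectionBaseChange_of_invol_eq_neg {x : A.baseChange R}
    (hx : (A.baseChange R).invol x = -x) :
    A.skewInclusion R (A.skewProjectionBaseChange R x) = x := by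
  rw [skewInclusion_skewProjectionBaseChange, hx, sub_neg_eq_add, ← two_smul R, smul_smul,
    algebraMap_invOf_two_mul_two, one_smul]

theorem psi_skewInclusion_one (v : R ⊗[k] A.skew) :
    algebraMap k R (⅟ (2 : k)) • (A.baseChange R).psi (A.skewInclusion R v) 1 =
      A.skewInclusion R v := by
  rw [psi_one_of_invol_eq_neg _ (A.invol_skewInclusion R v), smul_smul,
    algebraMap_invOf_two_mul_two, one_smul]

variable {A R}

/-- The map `α_S : s ↦ ½ψ(α(s), α(1))` that an isotopy `α` of `A_R` induces on the base change of
the skew elements. -/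
def Isotopy.skewMap (I : (A.baseChange R).Isotopy (A.baseChange R)) :
    R ⊗[k] A.skew →ₗ[R] R ⊗[k] A.skew :=
  A.skewProjectionBaseChange R ∘ₗ (algebraMap k R (⅟ (2 : k)) •
    ((LinearMap.mulRight R ((A.baseChange R).invol (I.toLinearEquiv 1)) -
      LinearMap.mulLeft R (I.toLinearEquiv 1) ∘ₗ (A.baseChange R).invol) ∘ₗ
        I.toLinearEquiv.toLinearMap ∘ₗ A.skewInclusion R))

theorem Isotopy.skewInclusion_skewMap (I : (A.baseChange R).Isotopy (A.baseChange R))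
    (v : R ⊗[k] A.skew) :
    A.skewInclusion R (I.skewMap v) = algebraMap k R (⅟ (2 : k)) •
      (A.baseChange R).psi (I.toLinearEquiv (A.skewInclusion R v)) (I.toLinearEquiv 1) := by
  apply skewInclusion_skewProjectionBaseChange_of_invol_eq_neg
  change (A.baseChange R).invol (algebraMap k R (⅟ (2 : k)) •
      (A.baseChange R).psi (I.toLinearEquiv (A.skewInclusion R v)) (I.toLinearEquiv 1)) =
    -(algebraMap k R (⅟ (2 : k)) •
      (A.baseChange R).psi (I.toLinearEquiv (A.skewInclusion R v)) (I.toLinearEquiv 1))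
  rw [map_smul, invol_psi, smul_neg]

/-- `α ↦ α_S` is multiplicative, evaluated on elements. -/
theorem Isotopy.psi_map_skewInclusion (I I' : (A.baseChange R).Isotopy (A.baseChange R))
    {v w : R ⊗[k] A.skew}
    (hw : A.skewInclusion R w = algebraMap k R (⅟ (2 : k)) •
      (A.baseChange R).psi (I.toLinearEquiv (A.skewInclusion R v)) (I.toLinearEquiv 1)) :
    (A.baseChange R).psi (I'.toLinearEquiv (A.skewInclusion R w)) (I'.toLinearEquiv 1) =
      (A.baseChange R).psi (I'.toLinearEquiv (I.toLinearEquiv (A.skewInclusion R v)))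
        (I'.toLinearEquiv (I.toLinearEquiv 1)) := by
  apply I'.psi_congr
  rw [psi_one_of_invol_eq_neg _ (A.invol_skewInclusion R w), hw, smul_smul,
    mul_comm, algebraMap_invOf_two_mul_two, one_smul]

theorem Isotopy.skewMap_symm_skewMap (I : (A.baseChange R).Isotopy (A.baseChange R))
    (v : R ⊗[k] A.skew) : I.symm.skewMap (I.skewMap v) = v := by
  rw [← A.skewProjectionBaseChange_skewInclusion R (I.symm.skewMap (I.skewMap v)),
    skewInclusion_skewMap, I.psi_map_skewInclusion I.symm (I.skewInclusion_skewMap v)]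
  simp only [Isotopy.symm, LinearEquiv.symm_apply_apply]
  rw [psi_skewInclusion_one, skewProjectionBaseChange_skewInclusion]

end BaseChange

end AlgebraWithInvolution

namespace AlbertForm

open AlgebraWithInvolution

variable {k : Type u} [Field k] {A : AlgebraWithInvolution k} (Φ : AlbertForm A)

theorem mul_natMap_add (s t : A.skew) (a : A) :
    (s : A.carrier) * ((Φ.natMap t : A.carrier) * a) +
      (t : A.carrier) * ((Φ.natMap s : A.carrier) * a) = -QuadraticMap.polar Φ.Q s t • a := by
  have h := Φ.mul_natMap (s + t) a
  have hs := Φ.mul_natMap s a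
  have ht := Φ.mul_natMap t a
  simp only [map_add, Submodule.coe_add, add_mul, mul_add, hs, ht] at h
  simp only [QuadraticMap.polar, neg_smul, sub_smul] at h ⊢
  rw [← sub_eq_zero] at h ⊢
  rw [← h]
  abel

theorem natMap_mul_of_ne_zero {e : A.skew} (he : Φ.Q e ≠ 0) (a : A) :
    (Φ.natMap e : A.carrier) * ((e : A.carrier) * a) = -(Φ.Q e) • a := by
  apply ((Φ.nonzero_iff e).1 he).injective
  simp only [Φ.mul_natMap, mul_smul_comm]

theorem natMap_mul {e : A.skew} (he : Φ.Q e ≠ 0) (s : A.skew) (a : A) :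
    (Φ.natMap s : A.carrier) * ((s : A.carrier) * a) = -(Φ.Q s) • a := by
  obtain ⟨b, hb : (e : A.carrier) * b = _⟩ :=
    ((Φ.nonzero_iff e).1 he).surjective ((s : A.carrier) * a)
  apply ((Φ.nonzero_iff e).1 he).injective
  have h₁ := Φ.mul_natMap_add s e ((s : A.carrier) * a)
  have h₂ := Φ.mul_natMap_add s e ((e : A.carrier) * a)
  rw [← hb, Φ.natMap_mul_of_ne_zero he] at h₁
  rw [Φ.natMap_mul_of_ne_zero he] at h₂
  have h₃ : (Φ.natMap s : A.carrier) * ((e : A.carrier) * a) =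
      -QuadraticMap.polar Φ.Q s e • a + Φ.Q e • b := by
    apply ((Φ.nonzero_iff e).1 he).injective
    simp only [mul_add, mul_smul_comm, hb, neg_smul, mul_neg] at h₂ ⊢
    rw [← h₂]
    abel
  have h₄ := Φ.mul_natMap s ((e : A.carrier) * a)
  rw [h₃] at h₄
  simp only [mul_add, mul_smul_comm, neg_smul, mul_neg, ← hb] at h₁ h₄ ⊢
  rw [← h₄, ← h₁]
  abel

theorem natMap_injective {e : A.skew} (he : Φ.Q e ≠ 0) : Function.Injective Φ.natMap := by
  have he₀ : Φ.natMap e ≠ 0 := by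
    intro h
    have h₁ := Φ.mul_natMap e (e : A.carrier)
    rw [h] at h₁
    simp only [ZeroMemClass.coe_zero, zero_mul, mul_zero, neg_smul, zero_eq_neg, smul_eq_zero, he,
      false_or, ZeroMemClass.coe_eq_zero] at h₁
    exact he (by rw [h₁, QuadraticMap.map_zero])
  rw [injective_iff_map_eq_zero]
  intro s hs
  have h := Φ.mul_natMap_add s e (e : A.carrier)
  have he₁ := Φ.natMap_mul_of_ne_zero he 1
  rw [mul_one] at he₁
  rw [he₁, hs] at h
  simp only [ZeroMemClass.coe_zero, zero_mul, mul_zero, add_zero, mul_one, mul_smul_comm, neg_smul,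
    mul_neg, neg_inj] at h
  have h' : Φ.Q e • s = QuadraticMap.polar Φ.Q s e • e := Subtype.ext h
  have h₁ := congrArg Φ.natMap h'
  rw [map_smul, map_smul, hs, smul_zero, eq_comm, smul_eq_zero, or_iff_left he₀] at h₁
  rwa [h₁, zero_smul, smul_eq_zero, or_iff_right he] at h'

section BaseChange

variable {R : Type u} [CommRing R] [Algebra k R] [Invertible (2 : k)]

/-- The `♮`-identities over `R` relating an isotopy and the map it induces on skew elements. -/
theorem smul_natMap_skewMap {e : A.skew} (he : Φ.Q e ≠ 0)
    (I : (A.baseChange R).Isotopy (A.baseChange R)) (v : R ⊗[k] A.skew) :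
    Φ.Q.baseChange R v •
        (A.skewInclusion R (Φ.natMap.baseChange R (I.skewMap v)) * I.toLinearEquiv 1) =
      Φ.Q.baseChange R (I.skewMap v) • I.hat (A.skewInclusion R (Φ.natMap.baseChange R v)) := by
  have hcomp : ∀ w : R ⊗[k] A.skew, A.skewInclusion R (Φ.natMap.baseChange R w) =
      (A.skew.subtype ∘ₗ Φ.natMap).baseChange R w := fun w => by
    rw [LinearMap.baseChange_comp]
    rfl
  have h := I.smul_natMap_eq (A.skewInclusion R) (Φ.natMap.baseChange R) (Φ.Q.baseChange R)
    (fun w a => ?_) (fun w a => ?_) I.skewMap (fun w a => ?_) v 1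
  · rwa [mul_one] at h
  · rw [hcomp]
    exact baseChange_mul_baseChange_mul Φ.Q A.skew.subtype (A.skew.subtype ∘ₗ Φ.natMap)
      Φ.mul_natMap w a
  · rw [hcomp]
    exact baseChange_mul_baseChange_mul Φ.Q (A.skew.subtype ∘ₗ Φ.natMap) A.skew.subtype
      (Φ.natMap_mul he) w a
  · rw [I.skewInclusion_skewMap]
    exact I.map_mul_of_skew (algebraMap_invOf_two_mul_two R) (A.invol_skewInclusion R w) a

theorem isUnit_baseChange_one_tmul (R : Type u) [CommRing R] [Algebra k R] {e : A.skew}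
    (he : Φ.Q e ≠ 0) : IsUnit (Φ.Q.baseChange R (1 ⊗ₜ e)) := by
  rw [QuadraticForm.baseChange_tmul, mul_one, ← Algebra.algebraMap_eq_smul_one]
  exact (IsUnit.mk0 _ he).map (algebraMap k R)

theorem exists_map_skewMap_eq_mul {e : A.skew} (he : Φ.Q e ≠ 0)
    (I : (A.baseChange R).Isotopy (A.baseChange R)) :
    ∃ μ : R, ∀ v, Φ.Q.baseChange R (I.skewMap v) = μ * Φ.Q.baseChange R v := by
  have heR := Φ.isUnit_baseChange_one_tmul R he
  by_cases ht : ∃ t, t ∉ Submodule.span k {e}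
  · obtain ⟨t, ht⟩ := ht
    have hinj : Function.Injective (A.skew.subtype ∘ₗ Φ.natMap) :=
      A.skew.injective_subtype.comp (Φ.natMap_injective he)
    obtain ⟨g, hg⟩ := LinearMap.exists_leftInverse_of_injective _ (LinearMap.ker_eq_bot.2 hinj)
    obtain ⟨l, hlt, hl⟩ := Submodule.exists_dual_map_eq_bot_of_notMem ht inferInstance
    have hle : l e = 0 := by
      have : l e ∈ (Submodule.span k {e}).map l :=
        Submodule.mem_map_of_mem (Submodule.mem_span_singleton_self e)
      rwa [hl, Submodule.mem_bot] at this
    let lR : (A.baseChange R).carrier →ₗ[R] R :=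
      (TensorProduct.AlgebraTensorModule.rid k R R).toLinearMap ∘ₗ
        LinearMap.baseChange R (((l t)⁻¹ • l) ∘ₗ g)
    have hlR : ∀ r s, lR (A.skewInclusion R (Φ.natMap.baseChange R (r ⊗ₜ s))) =
        ((l t)⁻¹ * l s) • r := by
      intro r s
      have hgs : g (Φ.natMap s) = s := LinearMap.congr_fun hg s
      change ((l t)⁻¹ • l (g (Φ.natMap s))) • r = _
      rw [hgs, smul_eq_mul]
    refine QuadraticMap.exists_eq_mul_of_mul_linear_eq
      (.of_mul_eq_one_right _ (algebraMap_invOf_two_mul_two (k := k) R))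
      (Φ.Q.baseChange R) ((Φ.Q.baseChange R).comp I.skewMap)
      (lR ∘ₗ A.skewInclusion R ∘ₗ Φ.natMap.baseChange R)
      (lR ∘ₗ I.hat.symm.toLinearMap ∘ₗ LinearMap.mulRight R (I.toLinearEquiv 1) ∘ₗ
        A.skewInclusion R ∘ₗ Φ.natMap.baseChange R ∘ₗ I.skewMap)
      (e := 1 ⊗ₜ e) (t := 1 ⊗ₜ t) ?_ ?_ heR fun v => ?_
    · exact (hlR 1 e).trans (by rw [hle, mul_zero, zero_smul])
    · exact (hlR 1 t).trans (by rw [inv_mul_cancel₀ hlt, one_smul])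
    · have h := congrArg (fun x => lR (I.hat.symm x)) (Φ.smul_natMap_skewMap he I v)
      simp only [map_smul, LinearEquiv.symm_apply_apply, smul_eq_mul] at h
      exact h.symm
  · push Not at ht
    obtain ⟨u, hu⟩ := heR
    have hspan : ∀ v : R ⊗[k] A.skew, ∃ r : R, v = r • (1 ⊗ₜ[k] e) := by
      intro v
      induction v with
      | zero => exact ⟨0, (zero_smul _ _).symm⟩
      | add v w hv hw =>
        obtain ⟨r, rfl⟩ := hv
        obtain ⟨r', rfl⟩ := hw
        exact ⟨r + r', (add_smul _ _ _).symm⟩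
      | tmul r s =>
        obtain ⟨c, rfl⟩ := Submodule.mem_span_singleton.1 (ht s)
        exact ⟨c • r, by rw [TensorProduct.tmul_smul, TensorProduct.smul_tmul',
          TensorProduct.smul_tmul', smul_eq_mul, mul_one]⟩
    refine ⟨Φ.Q.baseChange R (I.skewMap (1 ⊗ₜ e)) * (u⁻¹ : Rˣ), fun v => ?_⟩
    obtain ⟨r, rfl⟩ := hspan v
    rw [map_smul, QuadraticMap.map_smul, QuadraticMap.map_smul, ← hu, smul_eq_mul, smul_eq_mul]
    linear_combination (-r * r * Φ.Q.baseChange R (I.skewMap (1 ⊗ₜ e))) * u.inv_mul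

theorem exists_unit_map_skewMap_eq_mul (I : (A.baseChange R).Isotopy (A.baseChange R)) :
    ∃ μ : Rˣ, ∀ v, Φ.Q.baseChange R (I.skewMap v) = (μ : R) * Φ.Q.baseChange R v := by
  by_cases hQ : ∃ e, Φ.Q e ≠ 0
  · obtain ⟨e, he⟩ := hQ
    obtain ⟨μ, hμ⟩ := Φ.exists_map_skewMap_eq_mul he I
    obtain ⟨ν, hν⟩ := Φ.exists_map_skewMap_eq_mul he I.symm
    have h := hν (I.skewMap (1 ⊗ₜ e))
    rw [I.skewMap_symm_skewMap, hμ, ← mul_assoc] at h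
    have h₁ : ν * μ = 1 :=
      (Φ.isUnit_baseChange_one_tmul R he).mul_right_cancel (by rw [← h, one_mul])
    exact ⟨⟨μ, ν, by rw [mul_comm, h₁], h₁⟩, hμ⟩
  · have hQ₀ : Φ.Q = 0 := by
      ext e
      simpa using not_exists.1 hQ e
    exact ⟨1, fun v => by simp [hQ₀, QuadraticForm.baseChange, QuadraticForm.tmul]⟩

end BaseChange

end AlbertForm

/-- Let `k` be a field of characteristic not 2 or 3 and let `(A,−)` be an
`(m₁,m₂)`-product algebra with `S = Skew(A,−)` and Albert form `Q`.  For every commutative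
`k`-algebra `R` and every isotopy `α ∈ Str(A_R,−)`, the linear map `α_S : S_R → S_R` defined by
`α_S(s) = ½ψ(α(s), α(1))` is a similitude of `Q_R`; moreover `α ↦ α_S` is multiplicative and
unital (it defines a homomorphism of algebraic groups `γ : Str(A,−) → GO(S,Q)`). -/
theorem structure_group_to_similitudes
    {k : Type u} [Field k] [Invertible (2 : k)] (hk3 : (3 : k) ≠ 0)
    (m₁ m₂ : ℕ) (hm₁ : m₁ ∈ ({1, 2, 4, 8} : Set ℕ)) (hm₂ : m₂ ∈ ({1, 2, 4, 8} : Set ℕ))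
    (hne : (m₁, m₂) ≠ (2, 2))
    (A : AlgebraWithInvolution k) (hA : IsProductAlgebra A m₁ m₂)
    (Φ : AlbertForm A) :
    ∀ (R : Type u) [CommRing R] [Algebra k R],
      -- every isotopy of `A_R` induces a similitude `α_S` of the base-changed Albert form:
      (∀ I : (A.baseChange R).Isotopy (A.baseChange R),
        ∃ β : R ⊗[k] A.skew →ₗ[R] R ⊗[k] A.skew,
          (∀ v : R ⊗[k] A.skew,
            LinearMap.baseChange R A.skew.subtype (β v) =
              algebraMap k R (⅟ (2 : k)) •
                (A.baseChange R).psi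
                  (I.toLinearEquiv (LinearMap.baseChange R A.skew.subtype v))
                  (I.toLinearEquiv 1)) ∧
          ∃ μ : Rˣ, ∀ v : R ⊗[k] A.skew,
            (Φ.Q.baseChange R) (β v) = (μ : R) * (Φ.Q.baseChange R) v) ∧
      -- `α ↦ α_S` is multiplicative:
      (∀ (I I' : (A.baseChange R).Isotopy (A.baseChange R))
          (β β' : R ⊗[k] A.skew →ₗ[R] R ⊗[k] A.skew),
        (∀ v, LinearMap.baseChange R A.skew.subtype (β v) =
            algebraMap k R (⅟ (2 : k)) •
              (A.baseChange R).psi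
                (I.toLinearEquiv (LinearMap.baseChange R A.skew.subtype v))
                (I.toLinearEquiv 1)) →
        (∀ v, LinearMap.baseChange R A.skew.subtype (β' v) =
            algebraMap k R (⅟ (2 : k)) •
              (A.baseChange R).psi
                (I'.toLinearEquiv (LinearMap.baseChange R A.skew.subtype v))
                (I'.toLinearEquiv 1)) →
        ∀ v, LinearMap.baseChange R A.skew.subtype (β' (β v)) =
            algebraMap k R (⅟ (2 : k)) •
              (A.baseChange R).psi
                (I'.toLinearEquiv (I.toLinearEquiv (LinearMap.baseChange R A.skew.subtype v)))
                (I'.toLinearEquiv (I.toLinearEquiv 1))) ∧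
      -- `α ↦ α_S` is unital: the identity isotopy induces the identity map
      (∀ v : R ⊗[k] A.skew,
        LinearMap.baseChange R A.skew.subtype v =
          algebraMap k R (⅟ (2 : k)) •
            (A.baseChange R).psi (LinearMap.baseChange R A.skew.subtype v) 1) := by
  intro R _ _
  refine ⟨fun I => ⟨I.skewMap, I.skewInclusion_skewMap, Φ.exists_unit_map_skewMap_eq_mul I⟩,
    fun I I' β β' hβ hβ' v => ?_, fun v => (A.psi_skewInclusion_one R v).symm⟩
  exact (hβ' (β v)).trans (congrArg _ (I.psi_map_skewInclusion I' (hβ v)))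
end
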